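/- arXiv:1904.07626 — 7 statements merged into one kernel-verified Lean document; each statement's English description precedes it below -/
import Mathlib

section
/- Let q ≥ 4 be a prime power. For the Veronese code C_q, the number of 4-dimensional subcodes of each weight is: A_{q^2+q−1}^(4) = (q^4+2q^3+2q^2+q)/2, A_{q^2+q}^(4) = q^6+2q^5+2q^4+q^3+q^2+q+1, A_{q^2+q+1}^(4) = (2q^8+2q^7+2q^6+q^4−q)/2, and A_w^(4) = 0 for every other weight w. -/
noncomputable section

open MvPolynomial

/-- The projective plane over `F`: the projectivization of `F^3`. -/
abbrev Plane (F : Type*) [Field F] := Projectivization F (Fin 3 → F)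

/-- The Veronese code: evaluations of homogeneous degree-2 polynomials at the
chosen representatives of the points of the projective plane. -/
def VeroneseCode {F : Type*} [Field F] (rep : Plane F → (Fin 3 → F)) :
    Submodule F (Plane F → F) :=
  (MvPolynomial.homogeneousSubmodule (Fin 3) F 2).map
    (LinearMap.pi fun p => (MvPolynomial.aeval (rep p)).toLinearMap)

/-- The (Hamming) weight of a word: the size of its support. -/
def wt {α K : Type*} [Zero K] (g : α → K) : ℕ := Nat.card {p | g p ≠ 0}

/-- The weight of a subcode: the size of the union of supports of its elements. -/
def wtSub {F α : Type*} [Field F] (D : Submodule F (α → F)) : ℕ :=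
  Nat.card {p | ∃ c ∈ D, c p ≠ 0}

/-- The higher weight spectrum `A_w^(r)`: the number of subspaces of the Veronese
code of dimension `r` and weight `w`. -/
def hwSpectrum {F : Type*} [Field F] (rep : Plane F → (Fin 3 → F)) (r w : ℕ) : ℕ :=
  Nat.card {D : Submodule F (Plane F → F) //
    D ≤ VeroneseCode rep ∧ Module.finrank F ↥D = r ∧ wtSub D = w}

theorem pair_finrank {F W : Type*} [Field F] [AddCommGroup W] [Module F W] {v w : W}
    (hli : LinearIndependent F ![v, w]) : Module.finrank F (Submodule.span F {v, w}) = 2 := by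
  have hr := finrank_span_eq_card hli
  have : Set.range ![v, w] = {v, w} := by
    ext x; simp [or_comm, eq_comm]
  rw [this] at hr
  simpa using hr

open Classical in
theorem cntA {F W : Type*} [Field F] [Fintype F] [AddCommGroup W] [Module F W] [Fintype W]
    [Fintype (Submodule F W)] (v : W) (hv : v ≠ 0) :
    (Finset.univ.filter fun L : Submodule F W => Module.finrank F L = 2 ∧ v ∈ L).card *
      (Fintype.card F ^ 2 - Fintype.card F) = Fintype.card W - Fintype.card F := by
  have hfib := Finset.card_eq_sum_card_fiberwise
    (s := Finset.univ.filter fun w : W => w ∉ Submodule.span F {v})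
    (t := Finset.univ.filter fun L : Submodule F W => Module.finrank F L = 2 ∧ v ∈ L)
    (f := fun w => Submodule.span F {v, w}) (by
      intro w hw
      simp only [Finset.coe_filter, Finset.mem_univ, true_and, Set.mem_ofPred_eq] at hw ⊢
      refine ⟨?_, Submodule.subset_span (by simp)⟩
      have hli : LinearIndependent F ![v, w] := by
        rw [LinearIndependent.pair_iff' hv]
        intro a ha
        exact hw (Submodule.mem_span_singleton.2 ⟨a, ha⟩)
      exact pair_finrank hli)
  have hspan : Fintype.card (Submodule.span F {v}) = Fintype.card F := by
    rw [Module.card_eq_pow_finrank (K := F), finrank_span_singleton hv, pow_one]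
  have key : ∀ L : Submodule F W, Submodule.span F {v} ≤ L →
      (Finset.univ.filter fun w : W => w ∈ L ∧ w ∉ Submodule.span F {v}).card =
      Fintype.card L - Fintype.card F := by
    intro L hL
    have h1 : (Finset.univ.filter fun w : W => w ∈ L ∧ w ∉ Submodule.span F {v}) =
      (Finset.univ.filter fun w : W => w ∈ L) \ (Finset.univ.filter fun w : W => w ∈ Submodule.span F {v}) := by
      ext w; simp
    rw [h1, Finset.card_sdiff_of_subset, ← hspan, Fintype.card_subtype, Fintype.card_subtype]
    intro w; simp only [Finset.mem_filter, Finset.mem_univ, true_and]; exact fun h => hL h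
  have h0 := key ⊤ le_top
  rw [Fintype.card_congr (Submodule.topEquiv (R := F) (M := W)).toEquiv] at h0
  simp only [Submodule.mem_top, true_and] at h0
  rw [h0] at hfib
  rw [hfib, Finset.sum_const_nat]
  intro L hL
  simp only [Finset.mem_filter, Finset.mem_univ, true_and] at hL
  have hvL : Submodule.span F {v} ≤ L := by simpa using hL.2
  have := key L hvL
  rw [Module.card_eq_pow_finrank (K := F) (V := L), hL.1] at this
  rw [← this]
  congr 1
  ext w
  simp only [Finset.mem_filter, Finset.mem_univ, true_and]
  constructor
  · rintro ⟨h1, rfl⟩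
    exact ⟨Submodule.subset_span (by simp), h1⟩
  · rintro ⟨h1, h2⟩
    refine ⟨h2, ?_⟩
    have hli : LinearIndependent F ![v, w] := by
        rw [LinearIndependent.pair_iff' hv]
        intro a ha
        exact h2 (Submodule.mem_span_singleton.2 ⟨a, ha⟩)
    apply Submodule.eq_of_le_of_finrank_eq
    · rw [Submodule.span_le]; rintro x (rfl | rfl) <;> simp [h1, hL.2]
    · rw [hL.1, pair_finrank hli]

open Classical in
theorem cntT {F W : Type*} [Field F] [Fintype F] [AddCommGroup W] [Module F W] [Fintype W]
    [Fintype (Submodule F W)] (A : ℕ) (hA : ∀ v : W, v ≠ 0 → 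
    (Finset.univ.filter fun L : Submodule F W => Module.finrank F L = 2 ∧ v ∈ L).card = A) :
    (Finset.univ.filter fun L : Submodule F W => Module.finrank F L = 2).card *
      (Fintype.card F ^ 2 - 1) = (Fintype.card W - 1) * A := by
  have h := Finset.sum_card_bipartiteAbove_eq_sum_card_bipartiteBelow
    (s := Finset.univ.filter fun L : Submodule F W => Module.finrank F L = 2)
    (t := Finset.univ.filter fun v : W => v ≠ 0) (fun L v => v ∈ L)
  rw [Finset.sum_const_nat (m := Fintype.card F ^ 2 - 1), Finset.sum_const_nat (m := A)] at h
  · rw [h]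
    congr 1
    rw [Finset.filter_ne', Finset.card_erase_of_mem (Finset.mem_univ _)]; simp
  · intro v hv
    rw [← hA v (by simpa using hv), Finset.bipartiteBelow, Finset.filter_filter]
  · intro L hL
    simp only [Finset.mem_filter, Finset.mem_univ, true_and] at hL
    rw [← hL, ← Module.card_eq_pow_finrank (K := F) (V := L), Finset.bipartiteAbove, Finset.filter_filter,
      Fintype.card_subtype, ← Finset.card_erase_of_mem (a := (0:W)) (by simp)]
    congr 1
    ext x; simp

open Classical in
theorem cnt {F W P : Type*} [Field F] [Fintype F] [AddCommGroup W] [Module F W] [Fintype W] [Fintype P]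
    [Fintype (Submodule F W)] (A : ℕ) (hA : ∀ v : W, v ≠ 0 → 
    (Finset.univ.filter fun L : Submodule F W => Module.finrank F L = 2 ∧ v ∈ L).card = A) 
    (e : P → W) (hne : ∀ p, e p ≠ 0) (h3 : ∀ p1 p2 p3, p1 ≠ p3 → p2 ≠ p3 → e p3 ∉ Submodule.span F {e p1, e p2})
    (N : ℕ → ℕ) (hN : ∀ i, N i = (Finset.univ.filter fun L : Submodule F W => Module.finrank F L = 2 ∧
      (Finset.univ.filter fun p => e p ∈ L).card = i).card) :
    (∀ i, 3 ≤ i → N i = 0) ∧ 2 * N 2 = Fintype.card P * (Fintype.card P - 1) ∧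
    N 1 + 2 * N 2 = Fintype.card P * A ∧
    N 0 + N 1 + N 2 = (Finset.univ.filter fun L : Submodule F W => Module.finrank F L = 2).card := by
  set S := (Finset.univ.filter fun L : Submodule F W => Module.finrank F L = 2) with hS
  have hli : ∀ p1 p2, p1 ≠ p2 → Module.finrank F (Submodule.span F {e p1, e p2}) = 2 := by
    intro p1 p2 h
    have hli : LinearIndependent F ![e p1, e p2] := by
      rw [LinearIndependent.pair_iff' (hne _)]
      intro a ha
      apply h3 p1 p1 p2 h h
      rw [← ha]
      exact Submodule.smul_mem _ _ (Submodule.subset_span (by simp))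
    exact pair_finrank hli
  have huniq : ∀ p1 p2, p1 ≠ p2 → ∀ L ∈ S, e p1 ∈ L → e p2 ∈ L → Submodule.span F {e p1, e p2} = L := by
    intro p1 p2 h L hL h1 h2
    simp only [hS, Finset.mem_filter, Finset.mem_univ, true_and] at hL
    apply Submodule.eq_of_le_of_finrank_eq
    · rw [Submodule.span_le]; rintro x (rfl | rfl) <;> simp [h1, h2]
    · rw [hL, hli _ _ h]
  set m : Submodule F W → ℕ := fun L => (Finset.univ.filter fun p => e p ∈ L).card with hm
  have hN' : ∀ i, N i = ∑ L ∈ S, if m L = i then 1 else 0 := by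
    intro i; rw [hN, hS, ← Finset.card_filter, Finset.filter_filter]
  have hm2 : ∀ L ∈ S, m L ≤ 2 := by
    intro L hL
    by_contra hc
    push Not at hc
    obtain ⟨a, ha, b, hb, c, hc, hab, hac, hbc⟩ := Finset.two_lt_card.1 hc
    simp only [Finset.mem_filter, Finset.mem_univ, true_and] at ha hb hc
    exact h3 a b c hac hbc (by rw [huniq a b hab L hL ha hb]; exact hc)
  have hs1 : ∑ L ∈ S, m L = Fintype.card P * A := by
    have h := Finset.sum_card_bipartiteAbove_eq_sum_card_bipartiteBelow
      (s := S) (t := (Finset.univ : Finset P)) (fun L p => e p ∈ L)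
    rw [Finset.sum_const_nat (m := A) (s := Finset.univ)] at h
    · rw [Finset.card_univ] at h; exact h
    · intro p _
      rw [← hA (e p) (hne p), Finset.bipartiteBelow, Finset.filter_filter]
  have hs2 : ∑ L ∈ S, m L * (m L - 1) = Fintype.card P * (Fintype.card P - 1) := by
    have h := Finset.sum_card_bipartiteAbove_eq_sum_card_bipartiteBelow
      (s := S) (t := (Finset.univ : Finset P).offDiag) (fun L p => e p.1 ∈ L ∧ e p.2 ∈ L)
    rw [Finset.sum_const_nat (m := 1) (s := Finset.offDiag _)] at h
    · rw [Finset.offDiag_card] at h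
      simp only [Nat.mul_sub, mul_one]
      rw [mul_one, Finset.card_univ] at h
      rw [← h]
      refine Finset.sum_congr rfl fun L _ => ?_
      rw [← Finset.offDiag_card]
      congr 1
      ext ⟨a, b⟩
      simp [Finset.bipartiteAbove]
      tauto
    · rintro ⟨a, b⟩ hab
      simp at hab
      rw [Finset.card_eq_one]
      refine ⟨Submodule.span F {e a, e b}, ?_⟩
      ext L
      simp only [Finset.bipartiteBelow, Finset.mem_filter, Finset.mem_singleton]
      constructor
      · rintro ⟨h1, h2, h3⟩
        exact (huniq a b hab L h1 h2 h3).symm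
      · rintro rfl
        exact ⟨by simp [hS, hli a b hab], Submodule.subset_span (by simp), Submodule.subset_span (by simp)⟩
  refine ⟨?_, ?_, ?_, ?_⟩
  · intro i hi
    rw [hN']
    refine Finset.sum_eq_zero fun L hL => ?_
    have := hm2 L hL
    rw [if_neg (by omega)]
  · rw [← hs2, hN', Finset.mul_sum]
    refine Finset.sum_congr rfl fun L hL => ?_
    have := hm2 L hL
    interval_cases m L <;> simp
  · rw [← hs1, hN', hN', Finset.mul_sum, ← Finset.sum_add_distrib]
    refine Finset.sum_congr rfl fun L hL => ?_
    have := hm2 L hL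
    interval_cases m L <;> simp
  · rw [hN', hN', hN', ← Finset.sum_add_distrib, ← Finset.sum_add_distrib, Finset.card_eq_sum_ones]
    refine Finset.sum_congr rfl fun L hL => ?_
    have := hm2 L hL
    interval_cases m L <;> simp


/-- Evaluation at a point, as a functional on the code. -/
def evC {F : Type*} [Field F] (rep : Plane F → (Fin 3 → F)) (p : Plane F) :
    Module.Dual F (VeroneseCode rep) := (LinearMap.proj p).comp (VeroneseCode rep).subtype

theorem evC_apply {F : Type*} [Field F] (rep : Plane F → (Fin 3 → F)) (p : Plane F)
    (c : VeroneseCode rep) : evC rep p c = c.1 p := rfl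

theorem hom_eval_smul {F : Type*} [Field F] (f : MvPolynomial (Fin 3) F) (hf : f.IsHomogeneous 2)
    (a : F) (v : Fin 3 → F) : eval (a • v) f = a ^ 2 * eval v f := by
  rw [eval_eq', eval_eq', Finset.mul_sum]
  refine Finset.sum_congr rfl fun d hd => ?_
  have h1 := hf (MvPolynomial.mem_support_iff.1 hd)
  have h3 : d.degree = 2 := by
    rw [← h1]; exact (DFunLike.congr_fun Finsupp.degree_eq_weight_one d)
  have h4 : ∑ i, d i = 2 := by rw [← h3, Finsupp.degree_eq_sum]
  simp only [Pi.smul_apply, smul_eq_mul, mul_pow, Finset.prod_mul_distrib, Finset.prod_pow_eq_pow_sum, h4]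
  ring

theorem quad_injective {F : Type*} [Field F] [Fintype F] (hq4 : 4 ≤ Fintype.card F)
    (rep : Plane F → (Fin 3 → F))
    (hrep : ∀ p : Plane F, ∃ h : rep p ≠ 0, Projectivization.mk F (rep p) h = p)
    (f : MvPolynomial (Fin 3) F) (hf : f.IsHomogeneous 2) (h0 : ∀ p, aeval (rep p) f = 0) : f = 0 := by
  refine MvPolynomial.eq_zero_of_eval_zero_at_prod_finset f (fun _ => Finset.univ) ?_ ?_
  · intro i
    have h1 := f.degreeOf_le_totalDegree i
    have h2 := hf.totalDegree_le
    rw [Finset.card_univ]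
    omega
  · intro v _
    by_cases hv : v = 0
    · subst hv
      have h := hom_eval_smul f hf 0 (0 : Fin 3 → F)
      simpa using h
    · obtain ⟨h, hp⟩ := hrep (Projectivization.mk F v hv)
      rw [Projectivization.mk_eq_mk_iff'] at hp
      obtain ⟨a, ha⟩ := hp
      have h1 := h0 (Projectivization.mk F v hv)
      rw [← ha, MvPolynomial.aeval_eq_eval, hom_eval_smul f hf] at h1
      rcases mul_eq_zero.1 h1 with h2 | h2
      · exact absurd (by rw [← ha, pow_eq_zero_iff (two_ne_zero) |>.1 h2, zero_smul]) h
      · exact h2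

theorem finrank_quad {F : Type*} [Field F] :
    Module.finrank F (homogeneousSubmodule (Fin 3) F 2) = 6 := by
  rw [homogeneousSubmodule_eq_finsupp_supported]
  rw [(AddMonoidAlgebra.supportedEquivFinsupp (R := F) (S := F) {d : Fin 3 →₀ ℕ | d.degree = 2}).finrank_eq]
  have he : {d : Fin 3 →₀ ℕ | d.degree = 2} =
      ((Finset.univ : Finset (Fin 3)).finsuppAntidiag 2 : Set (Fin 3 →₀ ℕ)) := by
    ext d
    simp [Finsupp.degree_eq_sum]
  rw [he, Module.finrank_finsupp_self, ← Nat.card_eq_fintype_card, Nat.card_coe_set_eq,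
    Set.ncard_coe_finset, Finset.card_finsuppAntidiag_nat_eq_choose]
  rfl

theorem finrank_code {F : Type*} [Field F] [Fintype F] (hq4 : 4 ≤ Fintype.card F)
    (rep : Plane F → (Fin 3 → F))
    (hrep : ∀ p : Plane F, ∃ h : rep p ≠ 0, Projectivization.mk F (rep p) h = p) :
    Module.finrank F (VeroneseCode rep) = 6 := by
  rw [← finrank_quad (F := F), VeroneseCode]
  have := LinearMap.finrank_range_of_inj (f := (LinearMap.pi fun p : Plane F => 
    (MvPolynomial.aeval (R := F) (rep p)).toLinearMap).domRestrict (homogeneousSubmodule (Fin 3) F 2)) (by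
      rw [← LinearMap.ker_eq_bot, LinearMap.ker_eq_bot']
      rintro ⟨f, hf⟩ h
      ext1
      exact quad_injective hq4 rep hrep f hf fun p => congrFun h p)
  rw [← this, LinearMap.range_domRestrict]

theorem sep {F : Type*} [Field F] 
    (rep : Plane F → (Fin 3 → F))
    (hrep : ∀ p : Plane F, ∃ h : rep p ≠ 0, Projectivization.mk F (rep p) h = p)
    (p p' : Plane F) (hne : p ≠ p') : ∃ l : MvPolynomial (Fin 3) F, l.IsHomogeneous 1 ∧
      aeval (rep p) l = 0 ∧ aeval (rep p') l ≠ 0 := by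
  obtain ⟨h1, h1'⟩ := hrep p
  obtain ⟨h2, h2'⟩ := hrep p'
  have hn : rep p' ∉ Submodule.span F {rep p} := by
    intro h
    obtain ⟨a, ha⟩ := Submodule.mem_span_singleton.1 h
    apply hne
    rw [← h1', ← h2', eq_comm, Projectivization.mk_eq_mk_iff']
    exact ⟨a, ha⟩
  obtain ⟨φ, hφ, hφ'⟩ := Submodule.exists_le_ker_of_notMem hn
  have hev : ∀ v, aeval v (∑ i, C (φ (Pi.single i 1)) * X i : MvPolynomial (Fin 3) F) = φ v := by
    intro v
    rw [φ.pi_apply_eq_sum_univ v]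
    have : ∀ i : Fin 3, (fun j => if i = j then (1 : F) else 0) = Pi.single i 1 := by
      intro i; ext j; simp [Pi.single_apply, eq_comm]
    simp [mul_comm, this]
  refine ⟨∑ i, C (φ (Pi.single i 1)) * X i, ?_, ?_, ?_⟩
  · apply IsHomogeneous.sum
    intro i _
    simpa using (isHomogeneous_C (Fin 3) (φ (Pi.single i 1))).mul (isHomogeneous_X F i)
  · rw [hev]; exact hφ' (Submodule.mem_span_singleton_self _)
  · rw [hev]; exact hφ

theorem evC_three {F : Type*} [Field F] 
    (rep : Plane F → (Fin 3 → F))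
    (hrep : ∀ p : Plane F, ∃ h : rep p ≠ 0, Projectivization.mk F (rep p) h = p)
    (p1 p2 p3 : Plane F) (h1 : p1 ≠ p3) (h2 : p2 ≠ p3) :
    evC rep p3 ∉ Submodule.span F {evC rep p1, evC rep p2} := by
  intro h
  obtain ⟨a, b, hab⟩ := Submodule.mem_span_pair.1 h
  obtain ⟨l, hl, hl1, hl3⟩ := sep rep hrep p1 p3 h1
  obtain ⟨l', hl', hl1', hl3'⟩ := sep rep hrep p2 p3 h2
  have := DFunLike.congr_fun hab ⟨_, Submodule.mem_map_of_mem (hl.mul hl')⟩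
  simp only [aeval_eq_eval] at hl1 hl1' hl3 hl3'
  simp [evC_apply, hl1, hl1', hl3, hl3'] at this

theorem evC_ne {F : Type*} [Field F] 
    (rep : Plane F → (Fin 3 → F))
    (hrep : ∀ p : Plane F, ∃ h : rep p ≠ 0, Projectivization.mk F (rep p) h = p)
    (p : Plane F) : evC rep p ≠ 0 := by
  have : Nontrivial (Plane F) := by
    refine ⟨Projectivization.mk F ![1,0,0] (by simp), Projectivization.mk F ![0,1,0] (by simp), ?_⟩
    rw [Ne, Projectivization.mk_eq_mk_iff']
    rintro ⟨a, ha⟩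
    have := congrFun ha 0
    simp at this
  obtain ⟨p', hp⟩ := exists_ne p
  intro h
  apply evC_three rep hrep p' p' p hp hp
  rw [h]; exact zero_mem _

open Classical in
theorem spectrum_eq {F : Type*} [Field F] [Fintype F] (rep : Plane F → (Fin 3 → F)) [Fintype (Plane F)]
    [Fintype (Submodule F (Module.Dual F (VeroneseCode rep)))]
    (h6 : Module.finrank F (VeroneseCode rep) = 6) (w : ℕ) :
    hwSpectrum rep 4 w = (Finset.univ.filter fun L : Submodule F (Module.Dual F (VeroneseCode rep)) =>
      Module.finrank F L = 2 ∧
      (Finset.univ.filter fun p => evC rep p ∈ L).card + w = Fintype.card (Plane F)).card := by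
  have hw : ∀ D : Submodule F (VeroneseCode rep), wtSub (D.map (VeroneseCode rep).subtype) = w ↔ 
      (Finset.univ.filter fun p => evC rep p ∈ D.dualAnnihilator).card + w = Fintype.card (Plane F) := by
    intro D
    have h1 : wtSub (D.map (VeroneseCode rep).subtype) =
        (Finset.univ.filter fun p => ¬ evC rep p ∈ D.dualAnnihilator).card := by
      rw [wtSub, Nat.card_eq_fintype_card, Fintype.card_subtype]
      congr 1
      ext p
      simp [Submodule.mem_dualAnnihilator, evC_apply]
    have h2 := Finset.card_filter_add_card_filter_not (s := (Finset.univ : Finset (Plane F)))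
      (fun p => evC rep p ∈ D.dualAnnihilator)
    rw [Finset.card_univ] at h2
    rw [h1]; omega
  have hfr : ∀ D : Submodule F (VeroneseCode rep), Module.finrank F (D.map (VeroneseCode rep).subtype) = 
      Module.finrank F D := fun D => Submodule.finrank_map_subtype_eq _ D
  rw [hwSpectrum, ← Fintype.card_subtype, ← Nat.card_eq_fintype_card]
  refine Nat.card_congr ⟨fun D => ⟨(D.1.comap (VeroneseCode rep).subtype).dualAnnihilator, ?_⟩,
    fun L => ⟨L.1.dualCoannihilator.map (VeroneseCode rep).subtype, ?_⟩, ?_, ?_⟩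
  · obtain ⟨D, hD, hr, hwt⟩ := D
    have hDe : (D.comap (VeroneseCode rep).subtype).map (VeroneseCode rep).subtype = D := by
      rw [Submodule.map_comap_subtype, inf_eq_right.2 hD]
    refine ⟨?_, ?_⟩
    · have h3 := Subspace.finrank_add_finrank_dualAnnihilator_eq (D.comap (VeroneseCode rep).subtype)
      rw [← hfr, hDe, hr, h6] at h3
      dsimp only
      omega
    · dsimp only
      rw [← hw, hDe, hwt]
  · obtain ⟨L, hL, hm⟩ := L
    refine ⟨Submodule.map_subtype_le _ _, ?_, ?_⟩
    · rw [hfr]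
      have h3 := Subspace.finrank_add_finrank_dualCoannihilator_eq L
      dsimp only
      omega
    · rw [hw, Subspace.dualCoannihilator_dualAnnihilator_eq, hm]
  · rintro ⟨D, hD, hr, hwt⟩
    ext1
    dsimp only
    rw [Subspace.dualAnnihilator_dualCoannihilator_eq, Submodule.map_comap_subtype, inf_eq_right.2 hD]
  · rintro ⟨L, hL, hm⟩
    ext1
    dsimp only
    rw [Submodule.comap_map_eq_of_injective (Submodule.injective_subtype _),
      Subspace.dualCoannihilator_dualAnnihilator_eq]

theorem veronese_spectrum_dim_four
    {F : Type*} [Field F] [Fintype F] (q : ℕ) (hq : Fintype.card F = q) (hq4 : 4 ≤ q)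
    (rep : Plane F → (Fin 3 → F))
    (hrep : ∀ p : Plane F, ∃ h : rep p ≠ 0, Projectivization.mk F (rep p) h = p) :
    (hwSpectrum rep 4 (q ^ 2 + q - 1) : ℚ) = ((q : ℚ) ^ 4 + 2 * q ^ 3 + 2 * q ^ 2 + q) / 2 ∧
    (hwSpectrum rep 4 (q ^ 2 + q) : ℚ) =
      (q : ℚ) ^ 6 + 2 * q ^ 5 + 2 * q ^ 4 + q ^ 3 + q ^ 2 + q + 1 ∧
    (hwSpectrum rep 4 (q ^ 2 + q + 1) : ℚ) =
      (2 * (q : ℚ) ^ 8 + 2 * q ^ 7 + 2 * q ^ 6 + q ^ 4 - q) / 2 ∧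
    ∀ w : ℕ, w ∉ ({q ^ 2 + q - 1, q ^ 2 + q, q ^ 2 + q + 1} : Set ℕ) →
      hwSpectrum rep 4 w = 0 := by
  classical
  have h6 := finrank_code (by omega) rep hrep
  have : Finite (Plane F) := inferInstance
  let : Fintype (Plane F) := Fintype.ofFinite _
  have : Finite (Module.Dual F (VeroneseCode rep)) := Module.finite_of_finite F
  let : Fintype (Module.Dual F (VeroneseCode rep)) := Fintype.ofFinite _
  let : Fintype (Submodule F (Module.Dual F (VeroneseCode rep))) := Fintype.ofFinite _
  have hn : Fintype.card (Plane F) = q ^ 2 + q + 1 := by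
    rw [← Nat.card_eq_fintype_card, Projectivization.card_of_finrank F (Fin 3 → F) (n := 3) (by simp),
      Nat.card_eq_fintype_card, hq]
    simp [Finset.sum_range_succ]; ring
  have hW : Fintype.card (Module.Dual F (VeroneseCode rep)) = q ^ 6 := by
    rw [Module.card_eq_pow_finrank (K := F), Subspace.dual_finrank_eq, h6, hq]
  have hA1 := fun v hv => cntA (F := F) (W := Module.Dual F (VeroneseCode rep)) v hv
  rw [hq, hW] at hA1
  have hqq : q < q ^ 2 := by nlinarith
  have hq6 : q ^ 2 ≤ q ^ 6 := Nat.pow_le_pow_right (by omega) (by omega)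
  obtain ⟨v0, hv0⟩ : ∃ v : Module.Dual F (VeroneseCode rep), v ≠ 0 :=
    ⟨_, evC_ne rep hrep (Projectivization.mk F ![1,0,0] (by simp))⟩
  obtain ⟨A, hAdef⟩ : ∃ A, (Finset.univ.filter fun L : Submodule F (Module.Dual F (VeroneseCode rep)) =>
    Module.finrank F L = 2 ∧ v0 ∈ L).card = A := ⟨_, rfl⟩
  have hA2 := hA1 v0 hv0
  rw [hAdef] at hA2
  have hA : ∀ v : Module.Dual F (VeroneseCode rep), v ≠ 0 → 
    (Finset.univ.filter fun L : Submodule F (Module.Dual F (VeroneseCode rep)) =>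
    Module.finrank F L = 2 ∧ v ∈ L).card = A := by
    intro v hv
    have := hA1 v hv
    rw [← hA2] at this
    exact Nat.eq_of_mul_eq_mul_right (by omega) this
  have hT := cntT A hA
  rw [hq, hW] at hT
  obtain ⟨c3, c2, c1, c0⟩ := cnt A hA (evC rep) (evC_ne rep hrep) (evC_three rep hrep) _ (fun i => rfl)
  have hs := spectrum_eq rep h6
  rw [hn] at hs c1 c2
  have e1 : ∀ i w, w + i = q ^ 2 + q + 1 → hwSpectrum rep 4 w =
    (Finset.univ.filter fun L : Submodule F (Module.Dual F (VeroneseCode rep)) => Module.finrank F L = 2 ∧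
      (Finset.univ.filter fun p => evC rep p ∈ L).card = i).card := by
    intro i w hw
    rw [hs]
    congr 1
    ext L
    simp only [Finset.mem_filter, Finset.mem_univ, true_and]
    refine and_congr_right fun _ => ?_
    omega
  rw [← c0] at hT
  rw [← e1 2 (q ^ 2 + q - 1) (by omega)] at c2 c1 hT
  rw [← e1 1 (q ^ 2 + q) (by omega)] at c1 hT
  rw [← e1 0 (q ^ 2 + q + 1) (by omega)] at hT
  have hq1 : (4 : ℚ) ≤ q := by exact_mod_cast hq4
  have k2 : (2 : ℚ) * hwSpectrum rep 4 (q ^ 2 + q - 1) = (q ^ 2 + q + 1) * (q ^ 2 + q) := by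
    exact_mod_cast c2
  have k1 : (hwSpectrum rep 4 (q ^ 2 + q) : ℚ) + 2 * hwSpectrum rep 4 (q ^ 2 + q - 1) =
      (q ^ 2 + q + 1) * A := by exact_mod_cast c1
  have kA : (A : ℚ) = q ^ 4 + q ^ 3 + q ^ 2 + q + 1 := by
    have h := congrArg (Nat.cast (R := ℚ)) hA2
    rw [Nat.cast_mul, Nat.cast_sub hqq.le, Nat.cast_sub (by omega)] at h
    push_cast at h
    have hne : ((q : ℚ) ^ 2 - q) ≠ 0 := by nlinarith
    apply mul_right_cancel₀ hne
    rw [h]; ring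
  have kT : (hwSpectrum rep 4 (q ^ 2 + q + 1) : ℚ) + hwSpectrum rep 4 (q ^ 2 + q) +
      hwSpectrum rep 4 (q ^ 2 + q - 1) = (q ^ 4 + q ^ 2 + 1) * A := by
    have h := congrArg (Nat.cast (R := ℚ)) hT
    rw [Nat.cast_mul, Nat.cast_mul, Nat.cast_sub (by omega), Nat.cast_sub (by omega)] at h
    push_cast at h
    have hne : ((q : ℚ) ^ 2 - 1) ≠ 0 := by nlinarith
    apply mul_right_cancel₀ hne
    rw [h]; ring
  rw [kA] at k1 kT
  refine ⟨by linarith, by linarith, by linarith, ?_⟩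
  intro w hw
  simp only [Set.mem_insert_iff, Set.mem_singleton_iff, not_or] at hw
  by_cases hwn : w ≤ q ^ 2 + q + 1
  · rw [e1 (q ^ 2 + q + 1 - w) w (by omega)]
    exact c3 _ (by omega)
  · rw [hs, Finset.card_eq_zero, Finset.filter_eq_empty_iff]
    rintro L _ ⟨_, h⟩
    omega
end
end

section
/- Let q = 3, so F is the field with 3 elements and C_3 is the Veronese code of length 13. Its higher weight spectra are: A_6^(1)=78, A_9^(1)=247, A_{12}^(1)=39, A_8^(2)=117, A_9^(2)=286, A_{10}^(2)=1404, A_{11}^(2)=3042, A_{12}^(2)=3705, A_{13}^(2)=2457, A_9^(3)=13, A_{10}^(3)=234, A_{11}^(3)=2340, A_{12}^(3)=10296, A_{13}^(3)=20997, A_{11}^(4)=78, A_{12}^(4)=1417, A_{13}^(4)=9516, A_{12}^(5)=13, A_{13}^(5)=351, A_{13}^(6)=1, and A_w^(r) = 0 for every other pair (r,w) with r ≥ 1. -/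
noncomputable section

open MvPolynomial

/-! ### Part 1: the kernel computation -/

/-- Homogeneous coordinates (as natural numbers) of the 13 points. -/
def ptsN : List (ℕ × ℕ × ℕ) :=
  [(1, 0, 0), (0, 1, 0), (1, 1, 0), (2, 1, 0), (0, 0, 1), (0, 1, 1), (0, 2, 1), (1, 0, 1), (1, 1, 1), (1, 2, 1), (2, 0, 1), (2, 1, 1), (2, 2, 1)]

/-- The coordinates of the `i`-th point. -/
def ptN (i : ℕ) : ℕ × ℕ × ℕ := ptsN.getD i (1, 0, 0)

/-- The value, as a natural number, of the quadratic form with coefficient digits those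
of `x` in base 3, at the point `(a, b, c)`. -/
def formN (x : ℕ) (v : ℕ × ℕ × ℕ) : ℕ :=
  (x % 3) * (v.1 * v.1) + (x / 3 % 3) * (v.2.1 * v.2.1) + (x / 9 % 3) * (v.2.2 * v.2.2) +
  (x / 27 % 3) * (v.1 * v.2.1) + (x / 81 % 3) * (v.1 * v.2.2) + (x / 243 % 3) * (v.2.1 * v.2.2)

/-- The zero pattern of the form number `x` among the first `n` points. -/
def patN (x : ℕ) : ℕ → ℕ
  | 0 => 0
  | n + 1 => patN x n + bif Nat.beq (formN x (ptN n) % 3) 0 then 2 ^ n else 0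

/-- The zero patterns of all the 729 forms. -/
def patL : List ℕ :=
  [8191, 114, 114, 1169, 16, 6940, 1169, 6940, 16, 15, 2, 8066, 1, 6912, 1164, 7009, 108, 1248,
  15, 8066, 2, 7009, 1248, 108, 1, 1164, 6912, 1267, 2682, 4470, 3737, 4372, 16, 5525, 16, 2584,
  2563, 4362, 1158, 4361, 4, 3712, 101, 2656, 5608, 4355, 1162, 2566, 105, 3812, 4448, 2565,
  5504, 8, 1267, 4470, 2682, 5525, 2584, 16, 3737, 16, 4372, 4355, 2566, 1162, 2565, 8, 5504,
  105, 4448, 3812, 2563, 1158, 4362, 101, 5608, 2656, 4361, 3712, 4, 127, 7282, 1010, 6161, 1808,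
  156, 785, 1052, 6288, 7183, 898, 2, 1793, 128, 6156, 1121, 6380, 864, 911, 2, 7170, 225, 6240,
  1900, 6273, 780, 1024, 4723, 1402, 2294, 281, 3092, 4752, 2069, 5648, 408, 1283, 2186, 4614,
  3081, 4740, 256, 5733, 480, 2152, 2179, 4618, 1286, 4841, 356, 3168, 389, 2048, 5640, 2419,
  1654, 4346, 533, 5144, 2448, 4121, 3344, 660, 1539, 4230, 2314, 5125, 2440, 512, 3433, 736,
  4196, 4227, 2310, 1546, 2533, 616, 5216, 649, 4096, 3332, 127, 1010, 7282, 785, 6288, 1052,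
  6161, 156, 1808, 911, 7170, 2, 6273, 1024, 780, 225, 1900, 6240, 7183, 2, 898, 1121, 864, 6380,
  1793, 6156, 128, 2419, 4346, 1654, 4121, 660, 3344, 533, 2448, 5144, 4227, 1546, 2310, 649,
  3332, 4096, 2533, 5216, 616, 1539, 2314, 4230, 3433, 4196, 736, 5125, 512, 2440, 4723, 2294,
  1402, 2069, 408, 5648, 281, 4752, 3092, 2179, 1286, 4618, 389, 5640, 2048, 4841, 3168, 356,
  1283, 4614, 2186, 5733, 2152, 480, 3081, 256, 4740, 1183, 4626, 2322, 5841, 2384, 92, 3505, 60,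
  4656, 4687, 2370, 1218, 2337, 32, 5804, 1, 4620, 3456, 2351, 1186, 4642, 1, 5760, 2316, 4673,
  3532, 64, 7315, 282, 534, 1497, 596, 6224, 1717, 6192, 312, 323, 586, 7366, 553, 6180, 1440,
  6149, 256, 1672, 547, 7338, 294, 6153, 1412, 512, 325, 1728, 6216, 1939, 2070, 4122, 3285,
  4184, 848, 5305, 816, 2100, 2115, 4166, 1994, 4133, 808, 3232, 777, 2048, 5252, 4131, 1958,
  2090, 773, 3208, 4096, 2121, 5312, 836, 2591, 1298, 4242, 337, 5200, 2780, 4145, 3644, 432,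
  1359, 4290, 2626, 5153, 2720, 300, 3585, 396, 4096, 4271, 2594, 1314, 2689, 256, 5132, 449,
  4172, 3648, 275, 7706, 150, 6745, 1108, 464, 53, 1328, 6840, 7747, 202, 326, 1065, 420, 6688,
  1285, 6784, 8, 163, 298, 7718, 393, 6660, 1024, 6853, 64, 1352, 4115, 1046, 2970, 85, 3928,
  4304, 2873, 5168, 180, 1091, 3014, 4170, 3877, 4264, 32, 5129, 128, 2820, 2979, 4134, 1066,
  4229, 8, 3840, 201, 2880, 5188, 4383, 2194, 1554, 2129, 720, 5468, 561, 4540, 3120, 2255, 1602,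
  4418, 673, 5408, 2092, 4481, 3084, 512, 1583, 4386, 2210, 5377, 2048, 652, 3137, 588, 4544,
  531, 154, 7446, 89, 6612, 1616, 6453, 688, 1080, 195, 7498, 582, 6569, 1572, 32, 645, 1024,
  6408, 7459, 554, 166, 1545, 4, 6528, 1093, 6464, 712, 2067, 5014, 1050, 4949, 216, 3152, 57,
  2224, 5940, 5059, 1094, 2122, 165, 3112, 4896, 2185, 5888, 4, 1059, 2086, 5034, 3077, 4872,
  128, 5961, 64, 2244, 1183, 2322, 4626, 3505, 4656, 60, 5841, 92, 2384, 2351, 4642, 1186, 4673,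
  64, 3532, 1, 2316, 5760, 4687, 1218, 2370, 1, 3456, 4620, 2337, 5804, 32, 1939, 4122, 2070,
  5305, 2100, 816, 3285, 848, 4184, 4131, 2090, 1958, 2121, 836, 5312, 773, 4096, 3208, 2115,
  1994, 4166, 777, 5252, 2048, 4133, 3232, 808, 7315, 534, 282, 1717, 312, 6192, 1497, 6224, 596,
  547, 294, 7338, 325, 6216, 1728, 6153, 512, 1412, 323, 7366, 586, 6149, 1672, 256, 553, 1440,
  6180, 4383, 1554, 2194, 561, 3120, 4540, 2129, 5468, 720, 1583, 2210, 4386, 3137, 4544, 588,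
  5377, 652, 2048, 2255, 4418, 1602, 4481, 512, 3084, 673, 2092, 5408, 2067, 1050, 5014, 57,
  5940, 2224, 4949, 3152, 216, 1059, 5034, 2086, 5961, 2244, 64, 3077, 128, 4872, 5059, 2122,
  1094, 2185, 4, 5888, 165, 4896, 3112, 531, 7446, 154, 6453, 1080, 688, 89, 1616, 6612, 7459,
  166, 554, 1093, 712, 6464, 1545, 6528, 4, 195, 582, 7498, 645, 6408, 1024, 6569, 32, 1572,
  2591, 4242, 1298, 4145, 432, 3644, 337, 2780, 5200, 4271, 1314, 2594, 449, 3648, 4172, 2689,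
  5132, 256, 1359, 2626, 4290, 3585, 4096, 396, 5153, 300, 2720, 4115, 2970, 1046, 2873, 180,
  5168, 85, 4304, 3928, 2979, 1066, 4134, 201, 5188, 2880, 4229, 3840, 8, 1091, 4170, 3014, 5129,
  2820, 128, 3877, 32, 4264, 275, 150, 7706, 53, 6840, 1328, 6745, 464, 1108, 163, 7718, 298,
  6853, 1352, 64, 393, 1024, 6660, 7747, 326, 202, 1285, 8, 6784, 1065, 6688, 420]

theorem patL_eq : (List.range 729).map (fun x => patN x 13) = patL := by decide +kernel

theorem patN_bit : ∀ x < 729, ∀ i < 13,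
    (patN x 13 / 2 ^ i % 2 = 1 ↔ formN x (ptN i) % 3 = 0) := by decide +kernel

set_option synthInstance.maxSize 2000 in
set_option synthInstance.maxHeartbeats 400000 in
theorem pts_surj : ∀ a < 3, ∀ b < 3, ∀ c < 3, (a = 0 ∧ b = 0 ∧ c = 0) ∨
    ∃ i < 13, ∃ t < 3, (t * a) % 3 = (ptN i).1 % 3 ∧ (t * b) % 3 = (ptN i).2.1 % 3 ∧
      (t * c) % 3 = (ptN i).2.2 % 3 := by decide +kernel

set_option synthInstance.maxSize 2000 in
set_option synthInstance.maxHeartbeats 400000 in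
theorem pts_inj : ∀ i < 13, ∀ j < 13, ∀ t < 3, (t * (ptN j).1) % 3 = (ptN i).1 % 3 →
    (t * (ptN j).2.1) % 3 = (ptN i).2.1 % 3 → (t * (ptN j).2.2) % 3 = (ptN i).2.2 % 3 →
    i = j := by decide +kernel

theorem pts_ne (i : ℕ) :
    ¬ ((ptN i).1 % 3 = 0 ∧ (ptN i).2.1 % 3 = 0 ∧ (ptN i).2.2 % 3 = 0) := by
  rcases lt_or_ge i 13 with h | h
  · have : ∀ i < 13, ¬ ((ptN i).1 % 3 = 0 ∧ (ptN i).2.1 % 3 = 0 ∧ (ptN i).2.2 % 3 = 0) := by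
      decide +kernel
    exact this i h
  · have : ptN i = (1, 0, 0) := by
      rw [ptN, List.getD_eq_default]
      exact h
    simp [this]

/-- Filtering a list by the `i`-th bit, in continuation passing style. -/
def flt (i : ℕ) (k : List ℕ → ℕ) : List ℕ → List ℕ → ℕ
  | [], acc => k acc
  | x :: t, acc => bif Nat.beq (x / 2 ^ i % 2) 1 then flt i k t (x :: acc) else flt i k t acc

/-- Logarithm in base 3 of the powers of 3 up to 729. -/
def lg3 (m : ℕ) : ℕ :=
  bif Nat.beq m 1 then 0 else bif Nat.beq m 3 then 1 else bif Nat.beq m 9 then 2 else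
  bif Nat.beq m 27 then 3 else bif Nat.beq m 81 then 4 else bif Nat.beq m 243 then 5 else 6

/-- Sum over all subsets `U` of `range n` of `16384 ^ (7 * (j + |U|) + k(U))`. -/
def dfs : ℕ → ℕ → List ℕ → ℕ
  | 0, j, L => 16384 ^ (7 * j + lg3 L.length)
  | n + 1, j, L => dfs n j L + flt n (fun L' => dfs n (j + 1) L') L []

/-- The table of the numbers of sets with given size `j` and nullity `k`. -/
def tabN (j k : ℕ) : ℕ :=
  match j, k with
  | 0, 6 => 1
  | 1, 5 => 13
  | 2, 4 => 78
  | 3, 3 => 286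
  | 4, 2 => 702
  | 4, 3 => 13
  | 5, 1 => 1170
  | 5, 2 => 117
  | 6, 0 => 1170
  | 6, 1 => 546
  | 7, 0 => 1638
  | 7, 1 => 78
  | 8, 0 => 1287
  | 9, 0 => 715
  | 10, 0 => 286
  | 11, 0 => 78
  | 12, 0 => 13
  | 13, 0 => 1
  | _, _ => 0

theorem dfs_val : dfs 13 0 patL = ∑ c ∈ Finset.range 98, tabN (c / 7) (c % 7) * 16384 ^ c := by
  decide +kernel

theorem tabN_lt : ∀ c < 98, tabN (c / 7) (c % 7) < 16384 := by decide +kernel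

theorem flt_spec (i : ℕ) (k : List ℕ → ℕ) (hk : ∀ l l' : List ℕ, l.Perm l' → k l = k l')
    (L acc : List ℕ) :
    flt i k L acc = k (L.filter (fun x => decide (x / 2 ^ i % 2 = 1)) ++ acc) := by
  induction L generalizing acc with
  | nil => simp [flt]
  | cons x t ih =>
    rw [flt]
    by_cases h : x / 2 ^ i % 2 = 1
    · have hb : Nat.beq (x / 2 ^ i % 2) 1 = true := by rw [h]; rfl
      rw [hb, cond_true, ih, List.filter_cons_of_pos (by simpa using h)]
      exact hk _ _ List.perm_middle
    · have hb : Nat.beq (x / 2 ^ i % 2) 1 = false := by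
        rw [Bool.eq_false_iff]; intro h'; exact h (Nat.eq_of_beq_eq_true h')
      rw [hb, cond_false, ih, List.filter_cons_of_neg (by simpa using h)]

theorem dfs_spec (n j : ℕ) (L : List ℕ) :
    dfs n j L = ∑ U ∈ (Finset.range n).powerset, 16384 ^ (7 * (j + U.card) +
      lg3 (L.countP (fun x => decide (∀ i ∈ U, x / 2 ^ i % 2 = 1)))) := by
  induction n generalizing j L with
  | zero => simp [dfs]
  | succ n ih =>
    have hp : ∀ l l' : List ℕ, l.Perm l' → dfs n (j + 1) l = dfs n (j + 1) l' := by
      intro l l' h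
      rw [ih, ih]
      refine Finset.sum_congr rfl fun U _ => ?_
      rw [h.countP_eq]
    rw [dfs, flt_spec _ _ hp, List.append_nil, ih, ih, Finset.range_add_one,
      Finset.sum_powerset_insert (by simp)]
    congr 1
    refine Finset.sum_congr rfl fun U hU => ?_
    have hn : n ∉ U := fun h => by simpa using Finset.mem_powerset.1 hU h
    rw [Finset.card_insert_of_notMem hn, List.countP_filter]
    have : (fun x : ℕ => (decide (∀ i ∈ U, x / 2 ^ i % 2 = 1) && decide (x / 2 ^ n % 2 = 1)))
      = (fun x : ℕ => decide (∀ i ∈ insert n U, x / 2 ^ i % 2 = 1)) := by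
      funext x
      rw [← Bool.decide_and]
      congr 1
      simp [and_comm]
    rw [this]
    congr 2
    ring

theorem digits_unique (B : ℕ) (a b : ℕ → ℕ) (K : ℕ) (ha : ∀ c < K, a c < B)
    (hb : ∀ c < K, b c < B)
    (h : ∑ c ∈ Finset.range K, a c * B ^ c = ∑ c ∈ Finset.range K, b c * B ^ c) :
    ∀ c < K, a c = b c := by
  induction K generalizing a b with
  | zero => simp
  | succ K ih =>
    have key : ∀ f : ℕ → ℕ, ∑ c ∈ Finset.range (K + 1), f c * B ^ c =
        f 0 + B * ∑ c ∈ Finset.range K, f (c + 1) * B ^ c := by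
      intro f
      rw [Finset.sum_range_succ', Finset.mul_sum, add_comm]
      simp only [pow_zero, mul_one, pow_succ]
      congr 1
      refine Finset.sum_congr rfl fun c _ => by ring
    rw [key, key] at h
    have ha0 := ha 0 (by omega)
    have hb0 := hb 0 (by omega)
    have h0 : a 0 = b 0 := by
      have := congrArg (· % B) h
      simpa [Nat.add_mul_mod_self_left, Nat.mod_eq_of_lt ha0, Nat.mod_eq_of_lt hb0] using this
    have h1 : ∑ c ∈ Finset.range K, a (c + 1) * B ^ c = ∑ c ∈ Finset.range K, b (c + 1) * B ^ c := by
      rw [h0] at h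
      exact Nat.eq_of_mul_eq_mul_left (by omega) (Nat.add_left_cancel h)
    intro c hc
    rcases c with _ | c
    · exact h0
    · exact ih (fun c => a (c + 1)) (fun c => b (c + 1)) (fun c hc => ha _ (by omega))
        (fun c hc => hb _ (by omega)) h1 c (by omega)

/-- The number of forms vanishing at the points with index in `U`. -/
def vanN (U : Finset ℕ) : ℕ :=
  ((Finset.range 729).filter (fun x => ∀ i ∈ U, formN x (ptN i) % 3 = 0)).card

theorem card_filter_range (n : ℕ) (p : ℕ → Prop) [DecidablePred p] :
    ((Finset.range n).filter p).card = (List.range n).countP (fun x => decide (p x)) := by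
  rw [Finset.card_def, Finset.filter_val, ← Multiset.countP_eq_card_filter]
  change Multiset.countP _ (↑(List.range n) : Multiset ℕ) = _
  rw [Multiset.coe_countP]

theorem countP_patL (U : Finset ℕ) (hU : U ⊆ Finset.range 13) :
    patL.countP (fun x => decide (∀ i ∈ U, x / 2 ^ i % 2 = 1)) = vanN U := by
  rw [← patL_eq, List.countP_map, vanN, card_filter_range]
  refine List.countP_congr fun x hx => ?_
  have hx' : x < 729 := by simpa using hx
  simp only [Function.comp, decide_eq_true_eq]
  refine forall₂_congr fun i hi => patN_bit x hx' i (by simpa using hU hi)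

theorem lg3_lt (m : ℕ) : lg3 m < 7 := by
  unfold lg3
  simp only [Bool.cond_eq_ite]
  split_ifs <;> omega

theorem table (j k : ℕ) (hj : j < 14) (hk : k < 7) :
    ((Finset.powersetCard j (Finset.range 13)).filter (fun U => lg3 (vanN U) = k)).card
      = tabN j k := by
  set key : Finset ℕ → ℕ := fun U => 7 * U.card + lg3 (vanN U) with hkey
  have h1 : ∑ U ∈ (Finset.range 13).powerset, 16384 ^ key U =
      ∑ c ∈ Finset.range 98, tabN (c / 7) (c % 7) * 16384 ^ c := by
    rw [← dfs_val, dfs_spec]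
    refine Finset.sum_congr rfl fun U hU => ?_
    rw [countP_patL U (Finset.mem_powerset.1 hU), zero_add]
  have hmaps : ∀ U ∈ (Finset.range 13).powerset, key U ∈ Finset.range 98 := by
    intro U hU
    have := Finset.card_le_card (Finset.mem_powerset.1 hU)
    have h3 := lg3_lt (vanN U)
    simp only [Finset.card_range] at this
    simp only [hkey, Finset.mem_range]
    omega
  rw [← Finset.sum_fiberwise_of_maps_to hmaps] at h1
  have h2 : ∀ c, ∑ U ∈ (Finset.range 13).powerset with key U = c, 16384 ^ key U =
      ((Finset.range 13).powerset.filter (fun U => key U = c)).card * 16384 ^ c := by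
    intro c
    rw [Finset.sum_congr rfl (g := fun _ => 16384 ^ c)]
    · simp
    · intro U hU
      rw [(Finset.mem_filter.1 hU).2]
  simp only [h2] at h1
  have h4 := digits_unique 16384 _ _ 98 (fun c _ => lt_of_le_of_lt
    (Finset.card_filter_le _ _) (by rw [Finset.card_powerset, Finset.card_range]; norm_num))
    tabN_lt h1 (7 * j + k) (by omega)
  rw [show (7 * j + k) / 7 = j by omega, show (7 * j + k) % 7 = k by omega] at h4
  rw [← h4]
  refine congrArg Finset.card ?_
  ext U
  have h3 := lg3_lt (vanN U)
  simp only [Finset.mem_filter, Finset.mem_powersetCard, Finset.mem_powerset, hkey]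
  constructor
  · rintro ⟨⟨a, b⟩, c⟩; exact ⟨a, by omega⟩
  · rintro ⟨a, b⟩; exact ⟨⟨a, by omega⟩, by omega⟩

/-- Summing a function of the nullity over sets of size `j`. -/
theorem table_sum (G : ℕ → ℕ) (j : ℕ) (hj : j < 14) :
    ∑ U ∈ Finset.powersetCard j (Finset.range 13), G (lg3 (vanN U)) =
      ∑ k ∈ Finset.range 7, tabN j k * G k := by
  rw [← Finset.sum_fiberwise_of_maps_to (t := Finset.range 7) (g := fun U => lg3 (vanN U))
    (fun U _ => Finset.mem_range.2 (lg3_lt _))]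
  refine Finset.sum_congr rfl fun k hk => ?_
  rw [← table j k hj (Finset.mem_range.1 hk)]
  rw [Finset.sum_congr rfl (g := fun _ => G k)]
  · simp
  · intro U hU
    rw [(Finset.mem_filter.1 hU).2]

/-! ### Part 2: counting subspaces -/

theorem count_sub_mul {F M : Type*} [Field F] [Fintype F] [AddCommGroup M] [Module F M] [Finite M]
    (r : ℕ) (hr : r ≤ Module.finrank F M) :
    Nat.card {D : Submodule F M // Module.finrank F D = r} *
      ∏ i : Fin r, (Fintype.card F ^ r - Fintype.card F ^ i.val) =
      ∏ i : Fin r, (Fintype.card F ^ Module.finrank F M - Fintype.card F ^ i.val) := by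
  classical
  have : Fintype M := Fintype.ofFinite M
  rw [← card_linearIndependent (K := F) (V := M) hr]
  let f : (Σ D : {D : Submodule F M // Module.finrank F D = r},
      {s : Fin r → D.1 // LinearIndependent F s}) → {s : Fin r → M // LinearIndependent F s} :=
    fun x => ⟨fun i => (x.2.1 i : M), x.2.2.map' x.1.1.subtype (Submodule.ker_subtype _)⟩
  have hspan : ∀ x, Submodule.span F (Set.range (f x).1) = x.1.1 := by
    rintro ⟨⟨D, hD⟩, s, hs⟩
    apply Submodule.eq_of_le_of_finrank_eq
    · rw [Submodule.span_le]
      rintro _ ⟨i, rfl⟩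
      exact (s i).2
    · rw [finrank_span_eq_card (f _).2, Fintype.card_fin]
      exact hD.symm
  have hbij : Function.Bijective f := by
    constructor
    · intro x y hxy
      have h1 : x.1.1 = y.1.1 := by rw [← hspan x, ← hspan y, hxy]
      obtain ⟨⟨D, hD⟩, s, hs⟩ := x
      obtain ⟨⟨D', hD'⟩, s', hs'⟩ := y
      obtain rfl : D = D' := h1
      have : s = s' := by
        funext i
        apply Subtype.ext
        exact congrFun (congrArg Subtype.val hxy) i
      subst this
      rfl
    · rintro ⟨s, hs⟩
      refine ⟨⟨⟨Submodule.span F (Set.range s), ?_⟩,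
        fun i => ⟨s i, Submodule.subset_span ⟨i, rfl⟩⟩, ?_⟩, rfl⟩
      · rw [finrank_span_eq_card hs, Fintype.card_fin]
      · exact linearIndependent_span hs
  rw [← Nat.card_congr (Equiv.ofBijective f hbij), Nat.card_sigma]
  rw [Finset.sum_congr rfl
    (g := fun _ => ∏ i : Fin r, (Fintype.card F ^ r - Fintype.card F ^ i.val))]
  · simp [Nat.card_eq_fintype_card]
  · rintro ⟨D, hD⟩ _
    rw [card_linearIndependent (K := F) (V := D) hD.ge, hD]

/-- The Gaussian binomial coefficient for `q = 3`. -/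
def gauss3 (k r : ℕ) : ℕ :=
  (∏ i ∈ Finset.range r, (3 ^ k - 3 ^ i)) / ∏ i ∈ Finset.range r, (3 ^ r - 3 ^ i)

theorem count_sub {F M : Type*} [Field F] [Fintype F] (hq : Fintype.card F = 3)
    [AddCommGroup M] [Module F M] [Finite M] (r : ℕ) :
    Nat.card {D : Submodule F M // Module.finrank F D = r} = gauss3 (Module.finrank F M) r := by
  rcases le_or_gt r (Module.finrank F M) with hr | hr
  · have h := count_sub_mul (F := F) (M := M) r hr
    rw [hq, Fin.prod_univ_eq_prod_range (fun i => 3 ^ r - 3 ^ i) r,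
      Fin.prod_univ_eq_prod_range (fun i => 3 ^ Module.finrank F M - 3 ^ i) r] at h
    rw [gauss3, ← h, Nat.mul_div_cancel]
    refine Finset.prod_pos fun i hi => Nat.sub_pos_of_lt ?_
    exact Nat.pow_lt_pow_right (by norm_num) (Finset.mem_range.1 hi)
  · rw [gauss3, Finset.prod_eq_zero (i := Module.finrank F M) (Finset.mem_range.2 hr)
      (Nat.sub_self (3 ^ Module.finrank F M)), Nat.zero_div]
    rw [Nat.card_eq_zero]
    left
    refine ⟨fun ⟨D, hD⟩ => ?_⟩
    have := Submodule.finrank_le D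
    omega

theorem count_sub_le {F M : Type*} [Field F] [Fintype F] (hq : Fintype.card F = 3)
    [AddCommGroup M] [Module F M] [Finite M] (W : Submodule F M) (r : ℕ) :
    Nat.card {D : Submodule F M // D ≤ W ∧ Module.finrank F D = r} =
      gauss3 (Module.finrank F W) r := by
  rw [← count_sub hq (M := W) r]
  symm
  refine Nat.card_congr (Equiv.ofBijective (fun D => ⟨D.1.map W.subtype,
    Submodule.map_subtype_le _ _, ?_⟩) ⟨?_, ?_⟩)
  · rw [Submodule.finrank_map_subtype_eq, D.2]
  · intro D D' h
    apply Subtype.ext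
    exact Submodule.map_injective_of_injective W.subtype_injective (congrArg Subtype.val h)
  · rintro ⟨D, hD, hr⟩
    have h : (D.comap W.subtype).map W.subtype = D := by
      rw [Submodule.map_comap_subtype, inf_eq_right.2 hD]
    refine ⟨⟨D.comap W.subtype, ?_⟩, Subtype.ext h⟩
    rw [← Submodule.finrank_map_subtype_eq, h, hr]

/-- Words vanishing on the points with index in `U`. -/
def vanSub (F : Type*) [Field F] {α : Type*} (e : ℕ → α) (U : Finset ℕ) : Submodule F (α → F) where
  carrier := {c | ∀ i ∈ U, c (e i) = 0}
  add_mem' := by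
    intro a b ha hb i hi
    simp [ha i hi, hb i hi]
  zero_mem' := by intro i _; rfl
  smul_mem' := by
    intro t a ha i hi
    simp [ha i hi]

open Classical in
theorem wtSub_add {F α : Type*} [Field F] (e : ℕ → α) (N : ℕ)
    (hinj : ∀ i < N, ∀ j < N, e i = e j → i = j) (hsurj : ∀ p, ∃ i < N, e i = p)
    (D : Submodule F (α → F)) :
    wtSub D + ((Finset.range N).filter (fun i => ∀ c ∈ D, c (e i) = 0)).card = N := by
  have h : {p | ∃ c ∈ D, c p ≠ 0} =
      ↑(((Finset.range N).filter (fun i => ¬ ∀ c ∈ D, c (e i) = 0)).image e) := by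
    ext p
    simp only [Set.mem_ofPred_eq, Finset.coe_image, Set.mem_image, Finset.mem_coe,
      Finset.mem_filter, Finset.mem_range]
    constructor
    · rintro ⟨c, hc, hp⟩
      obtain ⟨i, hi, rfl⟩ := hsurj p
      exact ⟨i, ⟨hi, fun h => hp (h c hc)⟩, rfl⟩
    · rintro ⟨i, ⟨hi, h⟩, rfl⟩
      push Not at h
      exact h
  rw [wtSub, h, Nat.card_coe_set_eq, Set.ncard_coe_finset, Finset.card_image_of_injOn, add_comm,
    Finset.card_filter_add_card_filter_not, Finset.card_range]
  intro i hi j hj hij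
  simp only [Finset.coe_filter, Finset.mem_range, Set.mem_ofPred_eq] at hi hj
  exact hinj i hi.1 j hj.1 hij

/-- Binomial moments of the spectrum. -/
theorem moments {F α : Type*} [Field F] [Fintype F] (hq : Fintype.card F = 3) [Finite α]
    (e : ℕ → α) (N : ℕ)
    (hinj : ∀ i < N, ∀ j < N, e i = e j → i = j) (hsurj : ∀ p, ∃ i < N, e i = p)
    (C : Submodule F (α → F)) (r j : ℕ) :
    ∑ w ∈ Finset.range (N + 1), Nat.card {D : Submodule F (α → F) //
        D ≤ C ∧ Module.finrank F D = r ∧ wtSub D = w} * (N - w).choose j =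
      ∑ U ∈ Finset.powersetCard j (Finset.range N),
        gauss3 (Module.finrank F (C ⊓ vanSub F e U : Submodule F (α → F))) r := by
  classical
  have : Fintype (Submodule F (α → F)) := Fintype.ofFinite _
  set S : Finset (Submodule F (α → F)) :=
    Finset.univ.filter (fun D => D ≤ C ∧ Module.finrank F D = r) with hS
  have h1 : ∀ w, Nat.card {D : Submodule F (α → F) //
        D ≤ C ∧ Module.finrank F D = r ∧ wtSub D = w} = (S.filter (fun D => wtSub D = w)).card := by
    intro w
    rw [Nat.card_eq_fintype_card, Fintype.card_subtype, hS, Finset.filter_filter]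
    simp only [and_assoc]
  have h2 : ∀ U, gauss3 (Module.finrank F (C ⊓ vanSub F e U : Submodule F (α → F))) r =
      (S.filter (fun D => D ≤ vanSub F e U)).card := by
    intro U
    rw [← count_sub_le hq, Nat.card_eq_fintype_card, Fintype.card_subtype, hS,
      Finset.filter_filter]
    congr 1
    ext D
    simp only [Finset.mem_filter, le_inf_iff]
    tauto
  have hmaps : ∀ D ∈ S, wtSub D ∈ Finset.range (N + 1) := by
    intro D _
    have := wtSub_add e N hinj hsurj D
    rw [Finset.mem_range]
    omega
  have h3 : ∀ D : Submodule F (α → F), (N - wtSub D).choose j =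
      ((Finset.powersetCard j (Finset.range N)).filter (fun U => D ≤ vanSub F e U)).card := by
    intro D
    have := wtSub_add e N hinj hsurj D
    rw [show N - wtSub D = ((Finset.range N).filter (fun i => ∀ c ∈ D, c (e i) = 0)).card by omega,
      ← Finset.card_powersetCard]
    congr 1
    ext U
    simp only [Finset.mem_filter, Finset.mem_powersetCard]
    constructor
    · rintro ⟨a, b⟩
      refine ⟨⟨a.trans (Finset.filter_subset _ _), b⟩, fun c hc i hi => ?_⟩
      exact (Finset.mem_filter.1 (a hi)).2 c hc
    · rintro ⟨⟨a, b⟩, h⟩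
      exact ⟨fun i hi => Finset.mem_filter.2 ⟨a hi, fun c hc => h hc i hi⟩, b⟩
  calc _ = ∑ w ∈ Finset.range (N + 1), ∑ D ∈ S with wtSub D = w, (N - wtSub D).choose j := by
        refine Finset.sum_congr rfl fun w _ => ?_
        rw [h1, Finset.sum_congr rfl (g := fun _ => (N - w).choose j)]
        · simp
        · intro D hD
          rw [(Finset.mem_filter.1 hD).2]
    _ = ∑ D ∈ S, (N - wtSub D).choose j := Finset.sum_fiberwise_of_maps_to hmaps _
    _ = _ := by
        simp only [h2, h3, Finset.card_filter]
        exact Finset.sum_comm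

/-! ### Part 3: the Veronese code over the field with three elements -/

section concrete

variable {F : Type*} [Field F]

theorem charP_three [Fintype F] (hq : Fintype.card F = 3) : CharP F 3 := by
  have h0 : ((3 : ℕ) : F) = 0 := by rw [← hq]; exact FiniteField.cast_card_eq_zero F
  have h1 : ringChar F ∣ 3 := ringChar.dvd h0
  have h2 : ringChar F = 3 := by
    rcases (Nat.dvd_prime Nat.prime_three).1 h1 with h | h
    · exact absurd h CharP.ringChar_ne_one
    · exact h
  exact ringChar.of_eq h2

theorem cast_eq_iff [CharP F 3] (a b : ℕ) : (a : F) = (b : F) ↔ a % 3 = b % 3 :=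
  CharP.natCast_eq_natCast F 3

theorem exists_cast [Fintype F] (hq : Fintype.card F = 3) (a : F) : ∃ n : ℕ, n < 3 ∧ (n : F) = a := by
  have := charP_three hq
  have hb : Function.Bijective (fun n : Fin 3 => ((n : ℕ) : F)) := by
    rw [Fintype.bijective_iff_injective_and_card]
    refine ⟨fun m n h => ?_, by simp [hq]⟩
    have := (cast_eq_iff (F := F) m n).1 h
    omega
  obtain ⟨n, hn⟩ := hb.2 a
  exact ⟨n, n.2, hn⟩

/-- The quadratic form with the given six coefficients. -/
def qform (a b c d e f : F) (v : Fin 3 → F) : F :=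
  a * (v 0 * v 0) + b * (v 1 * v 1) + c * (v 2 * v 2) + d * (v 0 * v 1) + e * (v 0 * v 2) +
    f * (v 1 * v 2)

/-- The form number `x`. -/
def qnum (x : ℕ) (v : Fin 3 → F) : F :=
  qform ((x % 3 : ℕ) : F) ((x / 3 % 3 : ℕ) : F) ((x / 9 % 3 : ℕ) : F) ((x / 27 % 3 : ℕ) : F)
    ((x / 81 % 3 : ℕ) : F) ((x / 243 % 3 : ℕ) : F) v

/-- The coordinate vector of the `i`-th point. -/
def ptF (F : Type*) [Field F] (i : ℕ) : Fin 3 → F :=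
  ![((ptN i).1 : F), ((ptN i).2.1 : F), ((ptN i).2.2 : F)]

theorem qnum_ptF (x i : ℕ) : qnum x (ptF F i) = ((formN x (ptN i) : ℕ) : F) := by
  simp [qnum, qform, ptF, formN]

theorem qnum_smul (x : ℕ) (t : F) (v : Fin 3 → F) : qnum x (t • v) = t ^ 2 * qnum x v := by
  simp [qnum, qform]
  ring

theorem ptF_ne [CharP F 3] (i : ℕ) : ptF F i ≠ 0 := by
  intro h
  apply pts_ne i
  have h0 := congrFun h 0
  have h1 := congrFun h 1
  have h2 := congrFun h 2
  simp only [ptF, Matrix.cons_val, Pi.zero_apply] at h0 h1 h2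
  rw [← Nat.cast_zero, cast_eq_iff] at h0 h1 h2
  exact ⟨h0, h1, h2⟩

/-- The `i`-th point. -/
def ptP (F : Type*) [Field F] [CharP F 3] (i : ℕ) : Plane F :=
  Projectivization.mk F (ptF F i) (ptF_ne i)

theorem ptP_inj [Fintype F] (hq : Fintype.card F = 3) [CharP F 3] :
    ∀ i < 13, ∀ j < 13, ptP F i = ptP F j → i = j := by
  intro i hi j hj h
  rw [ptP, ptP, Projectivization.mk_eq_mk_iff'] at h
  obtain ⟨a, ha⟩ := h
  obtain ⟨n, hn, rfl⟩ := exists_cast hq a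
  have h0 := congrFun ha 0
  have h1 := congrFun ha 1
  have h2 := congrFun ha 2
  simp only [ptF, Matrix.cons_val, Pi.smul_apply, smul_eq_mul] at h0 h1 h2
  rw [← Nat.cast_mul, cast_eq_iff] at h0 h1 h2
  exact pts_inj i hi j hj n hn h0 h1 h2

theorem ptP_surj [Fintype F] (hq : Fintype.card F = 3) [CharP F 3] (p : Plane F) :
    ∃ i < 13, ptP F i = p := by
  induction p using Projectivization.ind with
  | h v hv =>
    obtain ⟨a, ha, ha'⟩ := exists_cast hq (v 0)
    obtain ⟨b, hb, hb'⟩ := exists_cast hq (v 1)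
    obtain ⟨c, hc, hc'⟩ := exists_cast hq (v 2)
    rcases pts_surj a ha b hb c hc with ⟨rfl, rfl, rfl⟩ | ⟨i, hi, t, ht, h0, h1, h2⟩
    · exfalso
      apply hv
      funext k
      fin_cases k
      · simpa using ha'.symm
      · simpa using hb'.symm
      · simpa using hc'.symm
    · refine ⟨i, hi, ?_⟩
      rw [ptP, Projectivization.mk_eq_mk_iff']
      refine ⟨(t : F), ?_⟩
      rw [← cast_eq_iff (F := F), Nat.cast_mul] at h0 h1 h2
      funext k
      fin_cases k
      · simpa [ptF, ← ha'] using h0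
      · simpa [ptF, ← hb'] using h1
      · simpa [ptF, ← hc'] using h2

theorem eval_homog (f : MvPolynomial (Fin 3) F) (hf : f ∈ homogeneousSubmodule (Fin 3) F 2) :
    ∃ a b c d e g : F, ∀ v : Fin 3 → F, MvPolynomial.aeval v f = qform a b c d e g v := by
  have hf' : f.IsHomogeneous 2 := hf
  rw [f.as_sum]
  have hd : ∀ m ∈ f.support, m 0 + m 1 + m 2 = 2 := by
    intro m hm
    have := hf' (MvPolynomial.mem_support_iff.1 hm)
    have h1 : m.degree = Finsupp.weight 1 m := by
      rw [Finsupp.degree_eq_weight_one]; rfl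
    rw [← h1] at this
    simpa [Finsupp.degree_eq_sum, Fin.sum_univ_three] using this
  generalize hc : (fun m => MvPolynomial.coeff m f) = co
  have hc' : ∀ m, MvPolynomial.coeff m f = co m := fun m => congrFun hc m
  simp only [hc']
  clear hc hc'
  generalize f.support = s at hd
  classical
  induction s using Finset.induction_on with
  | empty => exact ⟨0, 0, 0, 0, 0, 0, fun v => by simp [qform]⟩
  | insert m s hm ih =>
    obtain ⟨a, b, c, d, e, g, h⟩ := ih (fun m' hm' => hd m' (Finset.mem_insert_of_mem hm'))
    have h2 := hd m (Finset.mem_insert_self _ _)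
    have hmon : ∀ v : Fin 3 → F, MvPolynomial.aeval v (MvPolynomial.monomial m (co m)) =
        co m * (v 0 ^ m 0 * v 1 ^ m 1 * v 2 ^ m 2) := by
      intro v
      rw [MvPolynomial.aeval_monomial, Finsupp.prod_fintype _ _ (by simp), Fin.prod_univ_three]
      rfl
    simp only [Finset.sum_insert hm, map_add, hmon, h]
    have hcase : (m 0 = 2 ∧ m 1 = 0 ∧ m 2 = 0) ∨ (m 0 = 0 ∧ m 1 = 2 ∧ m 2 = 0) ∨
        (m 0 = 0 ∧ m 1 = 0 ∧ m 2 = 2) ∨ (m 0 = 1 ∧ m 1 = 1 ∧ m 2 = 0) ∨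
        (m 0 = 1 ∧ m 1 = 0 ∧ m 2 = 1) ∨ (m 0 = 0 ∧ m 1 = 1 ∧ m 2 = 1) := by omega
    rcases hcase with ⟨h0, h1, h2⟩ | ⟨h0, h1, h2⟩ | ⟨h0, h1, h2⟩ | ⟨h0, h1, h2⟩ |
      ⟨h0, h1, h2⟩ | ⟨h0, h1, h2⟩ <;> simp only [h0, h1, h2]
    · exact ⟨co m + a, b, c, d, e, g, fun v => by simp only [qform]; ring⟩
    · exact ⟨a, co m + b, c, d, e, g, fun v => by simp only [qform]; ring⟩
    · exact ⟨a, b, co m + c, d, e, g, fun v => by simp only [qform]; ring⟩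
    · exact ⟨a, b, c, co m + d, e, g, fun v => by simp only [qform]; ring⟩
    · exact ⟨a, b, c, d, co m + e, g, fun v => by simp only [qform]; ring⟩
    · exact ⟨a, b, c, d, e, co m + g, fun v => by simp only [qform]; ring⟩

theorem qform_mem (rep : Plane F → (Fin 3 → F)) (a b c d e g : F) :
    (fun p => qform a b c d e g (rep p)) ∈ VeroneseCode rep := by
  refine ⟨C a * (X 0 * X 0) + C b * (X 1 * X 1) + C c * (X 2 * X 2) + C d * (X 0 * X 1) +
    C e * (X 0 * X 2) + C g * (X 1 * X 2), ?_, ?_⟩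
  · have h : ∀ (t : F) (i j : Fin 3), C t * (X i * X j) ∈ homogeneousSubmodule (Fin 3) F 2 := by
      intro t i j
      rw [mem_homogeneousSubmodule]
      exact (((isHomogeneous_X F i).mul (isHomogeneous_X F j)).C_mul t)
    exact add_mem (add_mem (add_mem (add_mem (add_mem (h _ _ _) (h _ _ _)) (h _ _ _)) (h _ _ _))
      (h _ _ _)) (h _ _ _)
  · funext p
    simp [qform]

theorem mem_code_iff [Fintype F] (hq : Fintype.card F = 3) (rep : Plane F → (Fin 3 → F))
    (w : Plane F → F) :
    w ∈ VeroneseCode rep ↔ ∃ x < 729, (fun p => qnum x (rep p)) = w := by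
  constructor
  · rintro ⟨f, hf, rfl⟩
    obtain ⟨a, b, c, d, e, g, h⟩ := eval_homog f hf
    obtain ⟨a, ha, rfl⟩ := exists_cast hq a
    obtain ⟨b, hb, rfl⟩ := exists_cast hq b
    obtain ⟨c, hc, rfl⟩ := exists_cast hq c
    obtain ⟨d, hd, rfl⟩ := exists_cast hq d
    obtain ⟨e, he, rfl⟩ := exists_cast hq e
    obtain ⟨g, hg, rfl⟩ := exists_cast hq g
    refine ⟨a + 3 * b + 9 * c + 27 * d + 81 * e + 243 * g, by omega, ?_⟩
    funext p
    have h' : (LinearMap.pi fun p => (MvPolynomial.aeval (rep p)).toLinearMap :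
      MvPolynomial (Fin 3) F →ₗ[F] (Plane F → F)) f p = MvPolynomial.aeval (rep p) f := rfl
    rw [h', h, qnum]
    congr 2 <;> omega
  · rintro ⟨x, _, rfl⟩
    exact qform_mem rep _ _ _ _ _ _

variable [Fintype F] [CharP F 3] (rep : Plane F → (Fin 3 → F))
    (hrep : ∀ p : Plane F, ∃ h : rep p ≠ 0, Projectivization.mk F (rep p) h = p)

theorem rep_ptP
    (hrep : ∀ p : Plane F, ∃ h : rep p ≠ 0, Projectivization.mk F (rep p) h = p) (i : ℕ) :
    ∃ t : F, t ≠ 0 ∧ t • ptF F i = rep (ptP F i) := by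
  obtain ⟨h, hp⟩ := hrep (ptP F i)
  obtain ⟨t, ht⟩ := (Projectivization.mk_eq_mk_iff' F _ _ h (ptF_ne i)).1 hp
  refine ⟨t, ?_, ht⟩
  rintro rfl
  exact h (by rw [← ht, zero_smul])

theorem qnum_eq
    (hrep : ∀ p : Plane F, ∃ h : rep p ≠ 0, Projectivization.mk F (rep p) h = p) (i : ℕ)
    (x y : ℕ) : qnum x (rep (ptP F i)) = qnum y (rep (ptP F i)) ↔
      formN x (ptN i) % 3 = formN y (ptN i) % 3 := by
  obtain ⟨t, ht, h⟩ := rep_ptP rep hrep i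
  rw [← h, qnum_smul, qnum_smul, qnum_ptF, qnum_ptF, mul_right_inj' (pow_ne_zero 2 ht), cast_eq_iff]

theorem card_van (hq : Fintype.card F = 3)
    (hrep : ∀ p : Plane F, ∃ h : rep p ≠ 0, Projectivization.mk F (rep p) h = p) (U : Finset ℕ) :
    Nat.card (VeroneseCode rep ⊓ vanSub F (ptP F) U : Submodule F (Plane F → F)) = vanN U := by
  classical
  have h : ((VeroneseCode rep ⊓ vanSub F (ptP F) U : Submodule F (Plane F → F)) :
      Set (Plane F → F)) = ↑(((Finset.range 729).filter
        (fun x => ∀ i ∈ U, formN x (ptN i) % 3 = 0)).image (fun x p => qnum x (rep p))) := by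
    have hz : ∀ x i, qnum x (rep (ptP F i)) = 0 ↔ formN x (ptN i) % 3 = 0 := by
      intro x i
      have h1 := qnum_eq rep hrep i x 0
      have h2 : qnum 0 (rep (ptP F i)) = 0 := by simp [qnum, qform]
      have h3 : formN 0 (ptN i) = 0 := by simp [formN]
      rwa [h2, h3] at h1
    ext w
    simp only [Submodule.coe_inf, Set.mem_inter_iff, SetLike.mem_coe, mem_code_iff hq,
      Finset.coe_image, Set.mem_image, Finset.mem_coe, Finset.mem_filter, Finset.mem_range]
    constructor
    · rintro ⟨⟨x, hx, rfl⟩, hv⟩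
      exact ⟨x, ⟨hx, fun i hi => (hz x i).1 (hv i hi)⟩, rfl⟩
    · rintro ⟨x, ⟨hx, hv⟩, rfl⟩
      exact ⟨⟨x, hx, rfl⟩, fun i hi => (hz x i).2 (hv i hi)⟩
  change Nat.card ((VeroneseCode rep ⊓ vanSub F (ptP F) U : Submodule F (Plane F → F)) :
      Set (Plane F → F)) = _
  rw [h, Nat.card_coe_set_eq, Set.ncard_coe_finset, Finset.card_image_of_injOn]
  · rfl
  · intro x hx y hy hxy
    have hx' : x < 729 := by
      have := (Finset.mem_filter.1 (Finset.mem_coe.1 hx)).1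
      simpa using this
    have hy' : y < 729 := by
      have := (Finset.mem_filter.1 (Finset.mem_coe.1 hy)).1
      simpa using this
    have key : ∀ i, formN x (ptN i) % 3 = formN y (ptN i) % 3 := fun i =>
      (qnum_eq rep hrep i x y).1 (congrFun hxy (ptP F i))
    have k0 := key 0
    have k1 := key 1
    have k2 := key 2
    have k3 := key 4
    have k4 := key 5
    have k5 := key 7
    simp [formN, ptN, ptsN] at k0 k1 k2 k3 k4 k5
    omega

theorem finrank_van (hq : Fintype.card F = 3)
    (hrep : ∀ p : Plane F, ∃ h : rep p ≠ 0, Projectivization.mk F (rep p) h = p) (U : Finset ℕ) :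
    Module.finrank F (VeroneseCode rep ⊓ vanSub F (ptP F) U : Submodule F (Plane F → F)) =
      lg3 (vanN U) ∧
    Module.finrank F (VeroneseCode rep ⊓ vanSub F (ptP F) U : Submodule F (Plane F → F)) ≤ 6 := by
  set W := (VeroneseCode rep ⊓ vanSub F (ptP F) U : Submodule F (Plane F → F)) with hW
  have h1 : Nat.card W = 3 ^ Module.finrank F W := by
    rw [Module.natCard_eq_pow_finrank (K := F), Nat.card_eq_fintype_card, hq]
  have h2 : Nat.card W = vanN U := card_van rep hq hrep U
  have h3 : vanN U ≤ 729 := by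
    rw [vanN]
    exact (Finset.card_filter_le _ _).trans (by simp)
  have h4 : Module.finrank F W ≤ 6 := by
    by_contra hcon
    have : 3 ^ 7 ≤ 3 ^ Module.finrank F W := Nat.pow_le_pow_right (by norm_num) (by omega)
    rw [← h1, h2] at this
    omega
  refine ⟨?_, h4⟩
  rw [← h2, h1]
  generalize Module.finrank F W = k at h4
  have : ∀ k < 7, k = lg3 (3 ^ k) := by decide +kernel
  exact this k (by omega)

theorem moments_num (hq : Fintype.card F = 3)
    (hrep : ∀ p : Plane F, ∃ h : rep p ≠ 0, Projectivization.mk F (rep p) h = p)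
    (r j : ℕ) (hj : j < 14) :
    ∑ w ∈ Finset.range 14, hwSpectrum rep r w * (13 - w).choose j =
      ∑ k ∈ Finset.range 7, tabN j k * gauss3 k r := by
  rw [← table_sum (fun k => gauss3 k r) j hj]
  refine (moments hq (ptP F) 13 (ptP_inj hq) (ptP_surj hq) (VeroneseCode rep) r j).trans ?_
  refine Finset.sum_congr rfl fun U _ => ?_
  rw [(finrank_van rep hq hrep U).1]

theorem spectrum_big_w (hq : Fintype.card F = 3) (r w : ℕ) (hw : 13 < w) :
    hwSpectrum rep r w = 0 := by
  rw [hwSpectrum, Nat.card_eq_zero]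
  left
  refine ⟨fun ⟨D, _, _, hD⟩ => ?_⟩
  have := wtSub_add (ptP F) 13 (ptP_inj hq) (ptP_surj hq) D
  omega

theorem spectrum_big_r (hq : Fintype.card F = 3)
    (hrep : ∀ p : Plane F, ∃ h : rep p ≠ 0, Projectivization.mk F (rep p) h = p)
    (r w : ℕ) (hr : 6 < r) :
    hwSpectrum rep r w = 0 := by
  rw [hwSpectrum, Nat.card_eq_zero]
  left
  refine ⟨fun ⟨D, hD, h, _⟩ => ?_⟩
  have h1 := (finrank_van rep hq hrep ∅).2
  have h2 : D ≤ VeroneseCode rep ⊓ vanSub F (ptP F) ∅ :=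
    le_inf hD (fun c _ i hi => by simp at hi)
  have h3 := Submodule.finrank_mono h2
  omega

/-- Expected spectra. -/
def specN (r w : ℕ) : ℕ :=
  match r, w with
  | 1, 6 => 78
  | 1, 9 => 247
  | 1, 12 => 39
  | 2, 8 => 117
  | 2, 9 => 286
  | 2, 10 => 1404
  | 2, 11 => 3042
  | 2, 12 => 3705
  | 2, 13 => 2457
  | 3, 9 => 13
  | 3, 10 => 234
  | 3, 11 => 2340
  | 3, 12 => 10296
  | 3, 13 => 20997
  | 4, 11 => 78
  | 4, 12 => 1417
  | 4, 13 => 9516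
  | 5, 12 => 13
  | 5, 13 => 351
  | 6, 13 => 1
  | _, _ => 0

theorem specN_moments : ∀ r < 7, 1 ≤ r → ∀ j < 14,
    ∑ k ∈ Finset.range 7, tabN j k * gauss3 k r =
      ∑ w ∈ Finset.range 14, specN r w * (13 - w).choose j := by
  decide +kernel

/-- Binomial moments determine the sequence. -/
theorem moments_unique (a b : ℕ → ℕ) (h : ∀ j < 14, ∑ w ∈ Finset.range 14, a w * (13 - w).choose j =
      ∑ w ∈ Finset.range 14, b w * (13 - w).choose j) : ∀ w < 14, a w = b w := by
  intro w
  induction w using Nat.strong_induction_on with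
  | _ w ih =>
    intro hw
    have hj := h (13 - w) (by omega)
    have hs : ∀ f : ℕ → ℕ, ∑ w' ∈ Finset.range 14, f w' * (13 - w').choose (13 - w) =
        ∑ w' ∈ Finset.range w, f w' * (13 - w').choose (13 - w) + f w := by
      intro f
      rw [← Finset.sum_range_add_sum_Ico _ (show w + 1 ≤ 14 by omega), Finset.sum_range_succ,
        Nat.choose_self, mul_one, add_eq_left]
      refine Finset.sum_eq_zero fun v hv => ?_
      rw [Finset.mem_Ico] at hv
      rw [Nat.choose_eq_zero_of_lt (by omega), mul_zero]
    rw [hs, hs, Finset.sum_congr rfl (g := fun w' => b w' * (13 - w').choose (13 - w))] at hj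
    · exact Nat.add_left_cancel hj
    · intro v hv
      have hv' := Finset.mem_range.1 hv
      rw [ih v hv' (by omega)]

theorem spectrum_eq_s7 (hq : Fintype.card F = 3)
    (hrep : ∀ p : Plane F, ∃ h : rep p ≠ 0, Projectivization.mk F (rep p) h = p)
    (r w : ℕ) (hr : 1 ≤ r) : hwSpectrum rep r w = specN r w := by
  rcases lt_or_ge r 7 with h7 | h7
  · rcases lt_or_ge w 14 with hw | hw
    · exact moments_unique (hwSpectrum rep r) (specN r) (fun j hj =>
        (moments_num rep hq hrep r j hj).trans (specN_moments r h7 hr j hj)) w hw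
    · rw [spectrum_big_w rep hq r w (by omega)]
      unfold specN
      split <;> omega
  · rw [spectrum_big_r rep hq hrep r w (by omega)]
    unfold specN
    split <;> omega

end concrete

theorem veronese_spectrum_q_three
    {F : Type*} [Field F] [Fintype F] (hq : Fintype.card F = 3)
    (rep : Plane F → (Fin 3 → F))
    (hrep : ∀ p : Plane F, ∃ h : rep p ≠ 0, Projectivization.mk F (rep p) h = p) :
    hwSpectrum rep 1 6 = 78 ∧ hwSpectrum rep 1 9 = 247 ∧ hwSpectrum rep 1 12 = 39 ∧
    hwSpectrum rep 2 8 = 117 ∧ hwSpectrum rep 2 9 = 286 ∧ hwSpectrum rep 2 10 = 1404 ∧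
    hwSpectrum rep 2 11 = 3042 ∧ hwSpectrum rep 2 12 = 3705 ∧ hwSpectrum rep 2 13 = 2457 ∧
    hwSpectrum rep 3 9 = 13 ∧ hwSpectrum rep 3 10 = 234 ∧ hwSpectrum rep 3 11 = 2340 ∧
    hwSpectrum rep 3 12 = 10296 ∧ hwSpectrum rep 3 13 = 20997 ∧
    hwSpectrum rep 4 11 = 78 ∧ hwSpectrum rep 4 12 = 1417 ∧ hwSpectrum rep 4 13 = 9516 ∧
    hwSpectrum rep 5 12 = 13 ∧ hwSpectrum rep 5 13 = 351 ∧
    hwSpectrum rep 6 13 = 1 ∧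
    ∀ r w : ℕ, 1 ≤ r →
      ((r, w) : ℕ × ℕ) ∉ ({(1, 6), (1, 9), (1, 12), (2, 8), (2, 9), (2, 10), (2, 11),
        (2, 12), (2, 13), (3, 9), (3, 10), (3, 11), (3, 12), (3, 13), (4, 11), (4, 12),
        (4, 13), (5, 12), (5, 13), (6, 13)} : Set (ℕ × ℕ)) →
      hwSpectrum rep r w = 0 := by
  have := charP_three hq
  have key := spectrum_eq_s7 rep hq hrep
  refine ⟨?_, ?_, ?_, ?_, ?_, ?_, ?_, ?_, ?_, ?_, ?_, ?_, ?_, ?_, ?_, ?_, ?_, ?_, ?_, ?_, ?_⟩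
  on_goal 21 =>
    intro r w hr hrw
    rw [key r w hr]
    simp only [Set.mem_insert_iff, Set.mem_singleton_iff, Prod.mk.injEq] at hrw
    unfold specN
    split <;> first | rfl | (exfalso; revert hrw; simp)
  all_goals exact key _ _ (by norm_num)
end
end

section
/- Let q = 2, so F is the field with 2 elements and C_2 is the Veronese code of length 7. Its higher weight spectra are: A_2^(1)=21, A_4^(1)=35, A_6^(1)=7, A_3^(2)=35, A_4^(2)=105, A_5^(2)=210, A_6^(2)=210, A_7^(2)=91, A_4^(3)=35, A_5^(3)=210, A_6^(3)=560, A_7^(3)=590, A_5^(4)=21, A_6^(4)=175, A_7^(4)=455, A_6^(5)=7, A_7^(5)=56, A_7^(6)=1, and A_w^(r) = 0 for every other pair (r,w) with r ≥ 1. -/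
noncomputable section

open MvPolynomial

open Classical in
theorem grass_count {K V : Type*} [Field K] [AddCommGroup V] [Module K V] [Fintype K] [Finite V]
    (E : Submodule K V) (r : ℕ) :
    Nat.card {D : Submodule K V // D ≤ E ∧ Module.finrank K D = r} *
      (∏ i : Fin r, (Fintype.card K ^ r - Fintype.card K ^ (i : ℕ))) =
      ∏ i : Fin r, (Fintype.card K ^ Module.finrank K E - Fintype.card K ^ (i : ℕ)) := by
  have : Finite (Submodule K V) := Finite.of_injective _ (SetLike.coe_injective)
  by_cases hr : r ≤ Module.finrank K E
  · rw [← card_linearIndependent hr]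
    let _ : Fintype {D : Submodule K V // D ≤ E ∧ Module.finrank K D = r} := Fintype.ofFinite _
    let φ : (Σ D : {D : Submodule K V // D ≤ E ∧ Module.finrank K D = r},
        {s : Fin r → D.1 // LinearIndependent K s}) →
        {s : Fin r → E // LinearIndependent K s} := fun x =>
      ⟨fun i => Submodule.inclusion x.1.2.1 (x.2.1 i),
        x.2.2.map' (Submodule.inclusion x.1.2.1) (by
          rw [Submodule.ker_inclusion])⟩
    have hspan : ∀ x, Submodule.span K (Set.range fun i => ((φ x).1 i : V)) = x.1.1 := by
      rintro ⟨⟨D, hD, hDr⟩, s, hs⟩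
      have h1 := hs.span_eq_top_of_card_eq_finrank' (by simp [hDr])
      have h2 := congrArg (Submodule.map D.subtype) h1
      rw [Submodule.map_span, Submodule.map_top, Submodule.range_subtype, ← Set.range_comp] at h2
      exact h2
    have hφ : Function.Bijective φ := by
      constructor
      · intro x y hxy
        have h := hspan x
        rw [hxy, hspan y] at h
        obtain ⟨⟨D, hD⟩, s, hs⟩ := x
        obtain ⟨⟨D', hD'⟩, s', hs'⟩ := y
        obtain rfl : D' = D := h
        have : s = s' := by
          funext i
          have := congrArg (fun z => ((z.1 i : E) : V)) hxy
          exact Subtype.ext this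
        subst this
        rfl
      · rintro ⟨s, hs⟩
        have hs' : LinearIndependent K (fun i => (s i : V)) :=
          hs.map' E.subtype (Submodule.ker_subtype E)
        refine ⟨⟨⟨Submodule.span K (Set.range fun i => (s i : V)), ?_, ?_⟩,
          fun i => ⟨s i, Submodule.subset_span ⟨i, rfl⟩⟩, ?_⟩, ?_⟩
        · rw [Submodule.span_le]
          rintro _ ⟨i, rfl⟩
          exact (s i).2
        · simpa using finrank_span_eq_card hs'
        · exact linearIndependent_span hs'
        · rfl
    rw [← Nat.card_congr (Equiv.ofBijective φ hφ), Nat.card_sigma]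
    have : ∀ D : {D : Submodule K V // D ≤ E ∧ Module.finrank K D = r},
        Nat.card {s : Fin r → D.1 // LinearIndependent K s} =
        ∏ i : Fin r, (Fintype.card K ^ r - Fintype.card K ^ (i : ℕ)) := by
      intro D
      rw [card_linearIndependent D.2.2.ge, D.2.2]
    simp [this, Nat.card_eq_fintype_card]
  · push Not at hr
    have : IsEmpty {D : Submodule K V // D ≤ E ∧ Module.finrank K D = r} := by
      refine ⟨fun D => ?_⟩
      have := Submodule.finrank_mono D.2.1
      rw [D.2.2] at this
      omega
    rw [Nat.card_of_isEmpty, zero_mul, eq_comm]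
    exact Finset.prod_eq_zero (Finset.mem_univ ⟨Module.finrank K E, hr⟩) (by simp)

/-- The functions supported in `S` with vanishing total sum. -/
def evenOn {F P : Type*} [Field F] [Fintype P] (S : Finset P) : Submodule F (P → F) where
  carrier := {g | (∀ p, p ∉ S → g p = 0) ∧ ∑ p, g p = 0}
  add_mem' := by
    rintro a b ⟨h1, h2⟩ ⟨h3, h4⟩
    exact ⟨fun p hp => by simp [h1 p hp, h3 p hp], by simp [Finset.sum_add_distrib, h2, h4]⟩
  zero_mem' := by simp
  smul_mem' := by
    rintro c a ⟨h1, h2⟩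
    exact ⟨fun p hp => by simp [h1 p hp], by simp [← Finset.mul_sum, h2]⟩

theorem mem_evenOn {F P : Type*} [Field F] [Fintype P] (S : Finset P) (g : P → F) :
    g ∈ evenOn S ↔ (∀ p, p ∉ S → g p = 0) ∧ ∑ p, g p = 0 := Iff.rfl

open Classical in
theorem finrank_evenOn {F P : Type*} [Field F] [Fintype P] (S : Finset P) :
    Module.finrank F (evenOn (F := F) S) = S.card - 1 := by
  let σ : (S → F) →ₗ[F] F := ∑ p : S, LinearMap.proj p
  have hσ : ∀ g, σ g = ∑ p : S, g p := by intro g; simp [σ]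
  let e : evenOn (F := F) S ≃ₗ[F] LinearMap.ker σ :=
    { toFun := fun g => ⟨fun p => g.1 p, by
        rw [LinearMap.mem_ker, hσ, ← g.2.2, Finset.sum_coe_sort S (fun p => g.1 p)]
        exact Finset.sum_subset (Finset.subset_univ _) (fun p _ hp => g.2.1 p hp)⟩
      map_add' := fun _ _ => rfl
      map_smul' := fun _ _ => rfl
      invFun := fun g => ⟨fun p => if h : p ∈ S then g.1 ⟨p, h⟩ else 0, by
        refine ⟨fun p hp => by simp [hp], ?_⟩
        have := g.2
        rw [LinearMap.mem_ker, hσ] at this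
        refine Eq.trans ?_ this
        rw [← Finset.sum_subset (Finset.subset_univ S) (fun p _ hp => dif_neg hp),
          ← Finset.sum_coe_sort S]
        exact Finset.sum_congr rfl (fun p _ => by simp)⟩
      left_inv := by
        intro g
        ext p
        by_cases h : p ∈ S
        · simp [h]
        · simp [h, g.2.1 p h]
      right_inv := by
        intro g
        ext p
        simp }
  rw [e.finrank_eq]
  have h := σ.finrank_range_add_finrank_ker
  rw [Module.finrank_fintype_fun_eq_card, Fintype.card_coe] at h
  rcases S.eq_empty_or_nonempty with rfl | ⟨p, hp⟩
  · rw [Finset.card_empty] at h ⊢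
    omega
  · have hs : LinearMap.range σ = ⊤ := by
      rw [LinearMap.range_eq_top]
      intro a
      exact ⟨Pi.single ⟨p, hp⟩ a, by rw [hσ]; simp⟩
    rw [hs, finrank_top, Module.finrank_self] at h
    omega

/-- Number of `r`-dimensional even codes with full support on `w` points. -/
def fullCount (r w : ℕ) : ℕ :=
  (([[], [0, 0, 1, 0, 1, 0, 1, 0], [0, 0, 0, 1, 3, 10, 30, 91], [0, 0, 0, 0, 1, 10, 80, 590],
    [0, 0, 0, 0, 0, 1, 25, 455], [0, 0, 0, 0, 0, 0, 1, 56], [0, 0, 0, 0, 0, 0, 0, 1]] :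
      List (List ℕ)).getD r []).getD w 0

theorem fullCount_big (r w : ℕ) (hr : 7 ≤ r) : fullCount r w = 0 := by
  obtain ⟨k, rfl⟩ := Nat.exists_eq_add_of_le' hr
  rfl

theorem fullCount_spec : ∀ r < 7, 1 ≤ r → ∀ s < 8,
    (∑ m ∈ Finset.range (s + 1), s.choose m • fullCount r m) *
      (∏ i : Fin r, (2 ^ r - 2 ^ (i : ℕ))) = ∏ i : Fin r, (2 ^ (s - 1) - 2 ^ (i : ℕ)) := by
  decide +kernel

open Classical in
/-- The support of a subcode as a finset. -/
def suppF {F P : Type*} [Field F] [Fintype P] (D : Submodule F (P → F)) : Finset P :=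
  Finset.univ.filter (fun p => ∃ c ∈ D, c p ≠ 0)

theorem le_evenOn_iff {F P : Type*} [Field F] [Fintype P] (D : Submodule F (P → F))
    (S : Finset P) : D ≤ evenOn S ↔ D ≤ evenOn Finset.univ ∧ suppF D ⊆ S := by
  constructor
  · intro h
    refine ⟨fun g hg => ⟨by simp, (h hg).2⟩, fun p hp => ?_⟩
    simp only [suppF, Finset.mem_filter, Finset.mem_univ, true_and] at hp
    obtain ⟨c, hc, hcp⟩ := hp
    by_contra hpS
    exact hcp ((h hc).1 p hpS)
  · rintro ⟨h1, h2⟩ g hg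
    refine ⟨fun p hp => ?_, (h1 hg).2⟩
    by_contra hgp
    exact hp (h2 (by simp only [suppF, Finset.mem_filter, Finset.mem_univ, true_and]
                     exact ⟨g, hg, hgp⟩))

open Classical in
theorem count_exact {F P : Type*} [Field F] [Fintype F] (hq : Fintype.card F = 2) [Fintype P]
    (hP : Fintype.card P = 7) [Fintype (Submodule F (P → F))] (r : ℕ) (hr1 : 1 ≤ r) (hr : r < 7) :
    ∀ S : Finset P, (Finset.univ.filter (fun D : Submodule F (P → F) =>
      (D ≤ evenOn Finset.univ ∧ Module.finrank F D = r) ∧ suppF D = S)).card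
        = fullCount r S.card := by
  intro S
  induction S using Finset.strongInduction with
  | H S ih =>
    have hS : S.card < 8 := by
      have := Finset.card_le_univ S
      omega
    set f : Finset P → ℕ := fun S => (Finset.univ.filter (fun D : Submodule F (P → F) =>
      (D ≤ evenOn Finset.univ ∧ Module.finrank F D = r) ∧ suppF D = S)).card with hf
    have key : ∑ T ∈ S.powerset, f T = ∑ T ∈ S.powerset, fullCount r T.card := by
      rw [Finset.sum_powerset_apply_card (fun m => fullCount r m)]
      have h1 := grass_count (evenOn (F := F) S) r
      rw [finrank_evenOn, hq, ← fullCount_spec r hr hr1 _ hS] at h1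
      have hpos : 0 < ∏ i : Fin r, (2 ^ r - 2 ^ (i : ℕ)) := by
        refine Finset.prod_pos (fun i _ => ?_)
        have := Nat.pow_lt_pow_right (a := 2) (by norm_num) i.2
        omega
      rw [← Nat.eq_of_mul_eq_mul_right hpos h1, Nat.card_eq_fintype_card, Fintype.card_subtype,
        Finset.card_eq_sum_card_fiberwise (f := suppF) (t := S.powerset)]
      · refine Finset.sum_congr rfl (fun T hT => ?_)
        rw [hf, Finset.filter_filter]
        refine congrArg Finset.card ?_
        ext D
        simp only [Finset.mem_filter, Finset.mem_univ, true_and]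
        rw [le_evenOn_iff D S]
        rw [Finset.mem_powerset] at hT
        constructor
        · rintro ⟨⟨a, b⟩, rfl⟩
          exact ⟨⟨⟨a, hT⟩, b⟩, rfl⟩
        · rintro ⟨⟨⟨a, _⟩, b⟩, c⟩
          exact ⟨⟨a, b⟩, c⟩
      · intro D hD
        simp only [Finset.coe_filter, Finset.mem_univ, true_and, Set.mem_ofPred_eq] at hD
        simpa using ((le_evenOn_iff D S).1 hD.1).2
    have hmem : S ∈ S.powerset := Finset.mem_powerset_self S
    rw [← Finset.add_sum_erase _ _ hmem, ← Finset.add_sum_erase _ (fun T => fullCount r T.card) hmem]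
      at key
    have h2 : ∑ T ∈ S.powerset.erase S, f T = ∑ T ∈ S.powerset.erase S, fullCount r T.card := by
      refine Finset.sum_congr rfl (fun T hT => ?_)
      rw [Finset.mem_erase, Finset.mem_powerset] at hT
      exact ih T (lt_of_le_of_ne hT.2 hT.1)
    rw [h2] at key
    exact Nat.add_right_cancel key

open Classical in
theorem count_weight {F P : Type*} [Field F] [Fintype F] (hq : Fintype.card F = 2) [Fintype P]
    (hP : Fintype.card P = 7) (r w : ℕ) (hr1 : 1 ≤ r) (hr : r < 7) :
    Nat.card {D : Submodule F (P → F) //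
      D ≤ evenOn Finset.univ ∧ Module.finrank F D = r ∧ wtSub D = w} =
      Nat.choose 7 w * fullCount r w := by
  have : Finite (Submodule F (P → F)) := Finite.of_injective _ (SetLike.coe_injective)
  let _ : Fintype (Submodule F (P → F)) := Fintype.ofFinite _
  have hw : ∀ D : Submodule F (P → F), wtSub D = (suppF D).card := by
    intro D
    rw [wtSub, suppF, Nat.card_eq_fintype_card, ← Set.toFinset_card]
    congr 1
    ext p
    simp
  rw [Nat.card_eq_fintype_card, Fintype.card_subtype,
    Finset.card_eq_sum_card_fiberwise (f := suppF) (t := Finset.powersetCard w Finset.univ)]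
  · rw [← hP, ← Finset.card_univ, ← Finset.card_powersetCard, ← smul_eq_mul, ← Finset.sum_const]
    refine Finset.sum_congr rfl (fun T hT => ?_)
    rw [Finset.mem_powersetCard] at hT
    rw [← hT.2, ← count_exact hq hP r hr1 hr T, Finset.filter_filter]
    congr 1
    ext D
    simp only [Finset.mem_filter, Finset.mem_univ, true_and, hw]
    constructor
    · rintro ⟨⟨a, b, _⟩, c⟩
      exact ⟨⟨a, b⟩, c⟩
    · rintro ⟨⟨a, b⟩, c⟩
      exact ⟨⟨a, b, by rw [c]⟩, c⟩
  · intro D hD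
    simp only [Finset.coe_filter, Finset.mem_univ, true_and, Set.mem_ofPred_eq, hw] at hD
    simp [Finset.mem_powersetCard, hD.2.2]

theorem eq_zero_or_one {F : Type*} [Field F] [Fintype F] (hq : Fintype.card F = 2) (x : F) :
    x = 0 ∨ x = 1 := by
  classical
  by_contra h
  push Not at h
  have := Finset.card_le_univ ({0, 1, x} : Finset F)
  rw [Finset.card_eq_three.2 ⟨0, 1, x, zero_ne_one, h.1.symm, h.2.symm, rfl⟩] at this
  omega

theorem rep_mk {F : Type*} [Field F] [Fintype F] (hq : Fintype.card F = 2)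
    (rep : Plane F → (Fin 3 → F))
    (hrep : ∀ p : Plane F, ∃ h : rep p ≠ 0, Projectivization.mk F (rep p) h = p)
    (v : Fin 3 → F) (hv : v ≠ 0) : rep (Projectivization.mk F v hv) = v := by
  obtain ⟨h, h'⟩ := hrep (Projectivization.mk F v hv)
  rw [Projectivization.mk_eq_mk_iff'] at h'
  obtain ⟨a, ha⟩ := h'
  rcases eq_zero_or_one hq a with rfl | rfl
  · exact absurd (by rw [← ha, zero_smul]) h
  · rw [← ha, one_smul]

theorem card_plane {F : Type*} [Field F] [Fintype F] (hq : Fintype.card F = 2)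
    [Fintype (Plane F)] : Fintype.card (Plane F) = 7 := by
  rw [← Nat.card_eq_fintype_card, Projectivization.card_of_finrank F (Fin 3 → F) (n := 3) (by simp),
    Nat.card_eq_fintype_card, hq]
  rfl

open Classical in
theorem code_le {F : Type*} [Field F] [Fintype F] (hq : Fintype.card F = 2)
    [Fintype (Plane F)] (rep : Plane F → (Fin 3 → F))
    (hrep : ∀ p : Plane F, ∃ h : rep p ≠ 0, Projectivization.mk F (rep p) h = p) :
    VeroneseCode rep ≤ evenOn Finset.univ := by
  rintro g ⟨f, hf, rfl⟩
  refine ⟨by simp, ?_⟩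
  have hf' : f.IsHomogeneous 2 := hf
  have h := MvPolynomial.sum_eval_eq_zero f (by
    rw [hq, Fintype.card_fin]
    exact lt_of_le_of_lt hf'.totalDegree_le (by norm_num))
  have h0 : MvPolynomial.eval (0 : Fin 3 → F) f = 0 := by
    rw [MvPolynomial.eval_zero, MvPolynomial.constantCoeff_eq]
    exact hf'.coeff_eq_zero (by simp)
  rw [← Finset.add_sum_erase _ _ (Finset.mem_univ (0 : Fin 3 → F)), h0, zero_add] at h
  rw [← h]
  refine Finset.sum_bij (fun p _ => rep p) ?_ ?_ ?_ ?_
  · intro p _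
    simp [(hrep p).1]
  · intro p _ p' _ hpp
    obtain ⟨h1, h2⟩ := hrep p
    obtain ⟨h3, h4⟩ := hrep p'
    rw [← h2, ← h4]
    congr 1
  · intro v hv
    have hv' : v ≠ 0 := by simpa using hv
    exact ⟨Projectivization.mk F v hv', Finset.mem_univ _, rep_mk hq rep hrep v hv'⟩
  · intro p _
    simp [MvPolynomial.aeval_eq_eval]

theorem code_eq {F : Type*} [Field F] [Fintype F] (hq : Fintype.card F = 2)
    [Fintype (Plane F)] (rep : Plane F → (Fin 3 → F))
    (hrep : ∀ p : Plane F, ∃ h : rep p ≠ 0, Projectivization.mk F (rep p) h = p) :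
    VeroneseCode rep = evenOn Finset.univ := by
  refine Submodule.eq_of_le_of_finrank_le (code_le hq rep hrep) ?_
  rw [finrank_evenOn, Finset.card_univ, card_plane hq]
  let ψ : (Fin 6 → F) →ₗ[F] MvPolynomial (Fin 3) F := Fintype.linearCombination F
    ![X 0 * X 0, X 1 * X 1, X 2 * X 2, X 0 * X 1, X 0 * X 2, X 1 * X 2]
  have hψ : ∀ a, ψ a ∈ MvPolynomial.homogeneousSubmodule (Fin 3) F 2 := by
    intro a
    simp only [ψ, Fintype.linearCombination_apply]
    refine Submodule.sum_mem _ (fun i _ => Submodule.smul_mem _ _ ?_)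
    have hX : ∀ i j : Fin 3, (X i * X j : MvPolynomial (Fin 3) F) ∈
        MvPolynomial.homogeneousSubmodule (Fin 3) F 2 := fun i j =>
      (MvPolynomial.isHomogeneous_X F i).mul (MvPolynomial.isHomogeneous_X F j)
    fin_cases i <;> exact hX _ _
  let ev : MvPolynomial (Fin 3) F →ₗ[F] (Plane F → F) :=
    LinearMap.pi fun p => (MvPolynomial.aeval (rep p)).toLinearMap
  let θ : (Fin 6 → F) →ₗ[F] VeroneseCode rep :=
    (ev.comp ψ).codRestrict _ (fun a => ⟨ψ a, hψ a, rfl⟩)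
  have hθ : Function.Injective θ := by
    rw [← LinearMap.ker_eq_bot, LinearMap.ker_eq_bot']
    intro a ha
    have hv : ∀ v : Fin 3 → F, v ≠ 0 → a 0 * (v 0 * v 0) + a 1 * (v 1 * v 1) + a 2 * (v 2 * v 2)
        + a 3 * (v 0 * v 1) + a 4 * (v 0 * v 2) + a 5 * (v 1 * v 2) = 0 := by
      intro v hv
      have h := congrFun (congrArg Subtype.val ha) (Projectivization.mk F v hv)
      have h' : MvPolynomial.aeval (rep (Projectivization.mk F v hv)) (ψ a) = 0 := h
      rw [rep_mk hq rep hrep v hv] at h'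
      simpa [ψ, Fintype.linearCombination_apply, Fin.sum_univ_succ, add_assoc] using h'
    have nz : ∀ (v : Fin 3 → F) (i : Fin 3), v i = 1 → v ≠ 0 := by
      rintro v i h rfl
      simp at h
    have h0 := hv ![1, 0, 0] (nz _ 0 rfl)
    have h1 := hv ![0, 1, 0] (nz _ 1 rfl)
    have h2 := hv ![0, 0, 1] (nz _ 2 rfl)
    have h3 := hv ![1, 1, 0] (nz _ 0 rfl)
    have h4 := hv ![1, 0, 1] (nz _ 0 rfl)
    have h5 := hv ![0, 1, 1] (nz _ 1 rfl)
    simp at h0 h1 h2 h3 h4 h5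
    simp [h0, h1, h2] at h3 h4 h5
    funext i
    fin_cases i <;> simp [h0, h1, h2, h3, h4, h5]
  have := LinearMap.finrank_le_finrank_of_injective hθ
  simpa using this

theorem hwSpectrum_eq {F : Type*} [Field F] [Fintype F] (hq : Fintype.card F = 2)
    (rep : Plane F → (Fin 3 → F))
    (hrep : ∀ p : Plane F, ∃ h : rep p ≠ 0, Projectivization.mk F (rep p) h = p)
    (r w : ℕ) (hr : 1 ≤ r) : hwSpectrum rep r w = Nat.choose 7 w * fullCount r w := by
  let _ : Fintype (Plane F) := Fintype.ofFinite _
  by_cases h7 : r < 7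
  · rw [hwSpectrum, code_eq hq rep hrep]
    exact count_weight hq (card_plane hq) r w hr h7
  · have h0 : fullCount r w = 0 := by
      exact fullCount_big r w (by omega)
    rw [h0, mul_zero, hwSpectrum]
    have : IsEmpty {D : Submodule F (Plane F → F) //
        D ≤ VeroneseCode rep ∧ Module.finrank F ↥D = r ∧ wtSub D = w} := by
      refine ⟨fun D => ?_⟩
      have h1 := Submodule.finrank_mono D.2.1
      rw [D.2.2.1, code_eq hq rep hrep, finrank_evenOn, Finset.card_univ, card_plane hq] at h1
      omega
    exact Nat.card_of_isEmpty

theorem veronese_spectrum_q_two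
    {F : Type*} [Field F] [Fintype F] (hq : Fintype.card F = 2)
    (rep : Plane F → (Fin 3 → F))
    (hrep : ∀ p : Plane F, ∃ h : rep p ≠ 0, Projectivization.mk F (rep p) h = p) :
    hwSpectrum rep 1 2 = 21 ∧ hwSpectrum rep 1 4 = 35 ∧ hwSpectrum rep 1 6 = 7 ∧
    hwSpectrum rep 2 3 = 35 ∧ hwSpectrum rep 2 4 = 105 ∧ hwSpectrum rep 2 5 = 210 ∧
    hwSpectrum rep 2 6 = 210 ∧ hwSpectrum rep 2 7 = 91 ∧
    hwSpectrum rep 3 4 = 35 ∧ hwSpectrum rep 3 5 = 210 ∧ hwSpectrum rep 3 6 = 560 ∧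
    hwSpectrum rep 3 7 = 590 ∧
    hwSpectrum rep 4 5 = 21 ∧ hwSpectrum rep 4 6 = 175 ∧ hwSpectrum rep 4 7 = 455 ∧
    hwSpectrum rep 5 6 = 7 ∧ hwSpectrum rep 5 7 = 56 ∧
    hwSpectrum rep 6 7 = 1 ∧
    ∀ r w : ℕ, 1 ≤ r →
      ((r, w) : ℕ × ℕ) ∉ ({(1, 2), (1, 4), (1, 6), (2, 3), (2, 4), (2, 5), (2, 6), (2, 7),
        (3, 4), (3, 5), (3, 6), (3, 7), (4, 5), (4, 6), (4, 7), (5, 6), (5, 7),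
        (6, 7)} : Set (ℕ × ℕ)) →
      hwSpectrum rep r w = 0 := by
  have H := hwSpectrum_eq hq rep hrep
  refine ⟨?_, ?_, ?_, ?_, ?_, ?_, ?_, ?_, ?_, ?_, ?_, ?_, ?_, ?_, ?_, ?_, ?_, ?_, ?_⟩
  all_goals first
    | (rw [H _ _ (by norm_num)]; decide +kernel)
    | skip
  intro r w hr hrw
  rw [H r w hr]
  by_cases hw : w < 8
  · by_cases h7 : r < 7
    · simp only [Set.mem_insert_iff, Set.mem_singleton_iff, Prod.mk.injEq] at hrw
      interval_cases r <;> interval_cases w <;> first | rfl | simp at hrw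
    · rw [fullCount_big r w (by omega), mul_zero]
  · rw [Nat.choose_eq_zero_of_lt (by omega), zero_mul]
end
end

section
/- Let q ≥ 4 be a prime power, let L ⊆ P be a line, and let P_0 ∈ P ∖ L. Then the F-vector space of homogeneous degree-2 polynomials f ∈ F[x_0,x_1,x_2] satisfying f(rep p) = 0 for all p ∈ L ∪ {P_0} has dimension 2; equivalently, dim_F {c ∈ C_q : supp(c) ⊆ P ∖ (L ∪ {P_0})} = 2. Moreover X = P ∖ (L ∪ {P_0}) is inclusion-minimal with this property: every proper subset Y ⊊ X satisfies dim_F {c ∈ C_q : supp(c) ⊆ Y} ≤ 1. -/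
noncomputable section

open MvPolynomial

/-- Words vanishing outside `Y`, i.e. with support contained in `Y`. -/
def vanishingOutside {F : Type*} [Field F] {α : Type*} (Y : Set α) : Submodule F (α → F) where
  carrier := {g | ∀ p ∉ Y, g p = 0}
  add_mem' := by intro a b ha hb p hp; simp [ha p hp, hb p hp]
  zero_mem' := by intro p _; rfl
  smul_mem' := by intro c g hg p hp; simp [hg p hp]

/-- The linear form with given coefficients. -/
def linForm (F : Type*) [Field F] : (Fin 3 → F) →ₗ[F] MvPolynomial (Fin 3) F :=
  Fintype.linearCombination F (fun i => (X i : MvPolynomial (Fin 3) F))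

theorem eval_linForm {F : Type*} [Field F] (m v : Fin 3 → F) :
    eval v (linForm F m) = m 0 * v 0 + m 1 * v 1 + m 2 * v 2 := by
  simp [linForm, Fintype.linearCombination_apply, Fin.sum_univ_three]

theorem linForm_mem {F : Type*} [Field F] (m : Fin 3 → F) :
    (linForm F m).IsHomogeneous 1 := by
  rw [← mem_homogeneousSubmodule, linForm, Fintype.linearCombination_apply]
  exact Submodule.sum_mem _ fun i _ => Submodule.smul_mem _ _ (isHomogeneous_X F i)

theorem exists_linForm {F : Type*} [Field F] {l : MvPolynomial (Fin 3) F}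
    (hl : l ∈ homogeneousSubmodule (Fin 3) F 1) : ∃ a, l = linForm F a := by
  rw [homogeneousSubmodule_one_eq_span_X, Submodule.mem_span_range_iff_exists_fun] at hl
  obtain ⟨c, hc⟩ := hl
  exact ⟨c, by rw [← hc, linForm, Fintype.linearCombination_apply]⟩

theorem exists_quad {F : Type*} [Field F] {f : MvPolynomial (Fin 3) F}
    (hf : f ∈ homogeneousSubmodule (Fin 3) F 2) :
    ∃ c : Fin 3 → Fin 3 → F, ∀ v, eval v f = ∑ i, ∑ j, c i j * (v i * v j) := by
  rw [← homogeneousSubmodule_one_pow, pow_two] at hf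
  induction hf using Submodule.mul_induction_on' with
  | mem_mul_mem m hm n hn =>
    obtain ⟨a, rfl⟩ := exists_linForm hm
    obtain ⟨b, rfl⟩ := exists_linForm hn
    refine ⟨fun i j => a i * b j, fun v => ?_⟩
    rw [map_mul, eval_linForm, eval_linForm]
    simp only [Fin.sum_univ_three]
    ring
  | add x hx y hy h1 h2 =>
    obtain ⟨c, hc⟩ := h1
    obtain ⟨d, hd⟩ := h2
    refine ⟨fun i j => c i j + d i j, fun v => ?_⟩
    rw [map_add, hc, hd]
    simp only [Fin.sum_univ_three]
    ring

theorem poly_ext {F : Type*} [Field F] [Fintype F] (h4 : 4 ≤ Fintype.card F)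
    {f g : MvPolynomial (Fin 3) F} (hf : f.IsHomogeneous 2) (hg : g.IsHomogeneous 2)
    (h : ∀ v, eval v f = eval v g) : f = g := by
  refine hf.funext_of_le_card hg h ?_
  rw [Cardinal.mk_fintype]
  exact_mod_cast (by omega : 2 ≤ Fintype.card F)

theorem factor {F : Type*} [Field F] [Fintype F] (h4 : 4 ≤ Fintype.card F)
    (a w : Fin 3 → F) {f : MvPolynomial (Fin 3) F} (hf : f.IsHomogeneous 2)
    (hw : eval w (linForm F a) ≠ 0) (hfw : eval w f = 0)
    (h : ∀ v, eval v (linForm F a) = 0 → eval v f = 0) :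
    ∃ m, eval w (linForm F m) = 0 ∧ linForm F a * linForm F m = f := by
  obtain ⟨c, hc⟩ := exists_quad hf
  obtain ⟨k, hk⟩ : ∃ k, k * eval w (linForm F a) = 1 := ⟨_, inv_mul_cancel₀ hw⟩
  refine ⟨fun i => k * ∑ j, (c i j + c j i) * w j, ?_, ?_⟩
  · rw [hc] at hfw
    rw [eval_linForm]
    simp only [Fin.sum_univ_three] at hfw ⊢
    linear_combination 2 * k * hfw
  · refine poly_ext h4 ((linForm_mem a).mul (linForm_mem _)) hf fun v => ?_
    obtain ⟨t, ht⟩ : ∃ t, t = eval v (linForm F a) * k := ⟨_, rfl⟩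
    have h1 := h (fun i => v i - t * w i) (by
      rw [eval_linForm] at hk ht ⊢
      linear_combination (-(a 0 * w 0 + a 1 * w 1 + a 2 * w 2)) * ht
        - (a 0 * v 0 + a 1 * v 1 + a 2 * v 2) * hk)
    rw [map_mul, eval_linForm (fun i => k * ∑ j, (c i j + c j i) * w j)]
    rw [hc] at h1 hfw ⊢
    simp only [Fin.sum_univ_three] at h1 hfw ⊢
    generalize eval v (linForm F a) = lv at *
    subst ht
    linear_combination (lv * k) ^ 2 * hfw - h1

theorem exists_sep {F : Type*} [Field F] (w u : Fin 3 → F) (hw : w ≠ 0)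
    (h : ∀ m, eval w (linForm F m) = 0 → eval u (linForm F m) = 0) :
    ∃ a : F, a • w = u := by
  have key : ∀ i j, w i * u j = w j * u i := by
    intro i j
    have := h (w i • Pi.single j 1 - w j • Pi.single i 1) (by
      simp [linForm, mul_comm])
    simp [linForm] at this
    linear_combination this
  obtain ⟨k, hk⟩ := Function.ne_iff.mp hw
  have hk : w k ≠ 0 := hk
  refine ⟨u k / w k, ?_⟩
  ext i
  simp only [Pi.smul_apply, smul_eq_mul]
  field_simp
  linear_combination key i k

theorem veronese_line_plus_point_nullity_two
    {F : Type*} [Field F] [Fintype F] (q : ℕ) (hq : Fintype.card F = q) (hq4 : 4 ≤ q)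
    (rep : Plane F → (Fin 3 → F))
    (hrep : ∀ p : Plane F, ∃ h : rep p ≠ 0, Projectivization.mk F (rep p) h = p)
    (L : Set (Plane F))
    (hL : ∃ l : MvPolynomial (Fin 3) F, l ∈ MvPolynomial.homogeneousSubmodule (Fin 3) F 1 ∧
      l ≠ 0 ∧ L = {p : Plane F | MvPolynomial.eval (rep p) l = 0})
    (P₀ : Plane F) (hP₀ : P₀ ∉ L) :
    Module.finrank F ↥(MvPolynomial.homogeneousSubmodule (Fin 3) F 2 ⊓
      ⨅ p ∈ L ∪ {P₀}, LinearMap.ker ((MvPolynomial.aeval (rep p)).toLinearMap)) = 2 ∧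
    Module.finrank F ↥(VeroneseCode rep ⊓ vanishingOutside ((L ∪ {P₀})ᶜ)) = 2 ∧
    ∀ Y : Set (Plane F), Y ⊂ (L ∪ {P₀})ᶜ →
      Module.finrank F ↥(VeroneseCode rep ⊓ vanishingOutside Y) ≤ 1 := by
  subst hq
  obtain ⟨l, hl, hl0, rfl⟩ := hL
  obtain ⟨a, rfl⟩ := exists_linForm hl
  have hw : eval (rep P₀) (linForm F a) ≠ 0 := hP₀
  set w := rep P₀ with hwdef
  have hw0 : w ≠ 0 := (hrep P₀).1
  -- every vector is a multiple of a representative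
  have hvec : ∀ v : Fin 3 → F, v ≠ 0 → ∃ p, ∃ t : F, t ≠ 0 ∧ v = t • rep p := by
    intro v hv
    obtain ⟨h0, h1⟩ := hrep (Projectivization.mk F v hv)
    obtain ⟨t, ht⟩ := (Projectivization.mk_eq_mk_iff F _ _ hv h0).1 h1.symm
    exact ⟨_, t, t.ne_zero, ht.symm⟩
  have hsc : ∀ f : MvPolynomial (Fin 3) F, f.IsHomogeneous 2 → ∀ (t : F) v,
      eval (t • v) f = t ^ 2 * eval v f := by
    intro f hf t v
    obtain ⟨c, hc⟩ := exists_quad hf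
    rw [hc, hc]
    simp only [Fin.sum_univ_three, Pi.smul_apply, smul_eq_mul]
    ring
  have hzero : ∀ f : MvPolynomial (Fin 3) F, f.IsHomogeneous 2 → eval 0 f = 0 := by
    intro f hf
    have := hsc f hf 0 0
    simpa using this
  let φ : (Fin 3 → F) →ₗ[F] MvPolynomial (Fin 3) F :=
    (LinearMap.mulLeft F (linForm F a)) ∘ₗ linForm F
  have hφ : ∀ m, φ m = linForm F a * linForm F m := fun m => rfl
  have hφh : ∀ m, (φ m).IsHomogeneous 2 := fun m => (linForm_mem a).mul (linForm_mem m)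
  let ev : MvPolynomial (Fin 3) F →ₗ[F] (Plane F → F) :=
    LinearMap.pi fun p => (MvPolynomial.aeval (rep p)).toLinearMap
  have hev : ∀ f p, ev f p = eval (rep p) f := fun f p => by
    simp [ev, MvPolynomial.aeval_eq_eval]
  have hlin : Function.Injective (linForm F) := by
    rw [← LinearMap.ker_eq_bot, LinearMap.ker_eq_bot']
    intro m hm
    ext i
    have := congrArg (eval (Pi.single i 1)) hm
    simpa [linForm, Fintype.linearCombination_apply, Pi.single_apply] using this
  have hφinj : Function.Injective φ := fun m n h => hlin (mul_left_cancel₀ hl0 h)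
  have hevz : ∀ f : MvPolynomial (Fin 3) F, f.IsHomogeneous 2 → ev f = 0 → f = 0 := by
    intro f hf h
    refine poly_ext hq4 hf (isHomogeneous_zero _ _ _) fun v => ?_
    rw [map_zero]
    by_cases hv : v = 0
    · rw [hv, hzero f hf]
    · obtain ⟨p, t, -, rfl⟩ := hvec v hv
      rw [hsc f hf, ← hev, h]; simp
  have hcinj : Function.Injective (ev ∘ₗ φ) := by
    rw [← LinearMap.ker_eq_bot, LinearMap.ker_eq_bot']
    intro m hm
    exact hφinj ((hevz _ (hφh m) hm).trans (map_zero φ).symm)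
  let δ : (Fin 3 → F) →ₗ[F] F := (MvPolynomial.aeval w).toLinearMap ∘ₗ linForm F
  have hδ : ∀ m, δ m = eval w (linForm F m) := fun m => by
    simp [δ, MvPolynomial.aeval_eq_eval]
  have hK : Module.finrank F (LinearMap.ker δ) = 2 := by
    have h0 : δ ≠ 0 := fun h => hw (by rw [← hδ, h]; rfl)
    have := Module.Dual.finrank_ker_add_one_of_ne_zero (f := δ) h0
    simp at this
    omega
  -- characterization of the polynomials
  have hchar : ∀ f : MvPolynomial (Fin 3) F, f.IsHomogeneous 2 →
      ((∀ p ∈ {p | eval (rep p) (linForm F a) = 0} ∪ {P₀}, eval (rep p) f = 0) ↔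
        f ∈ (LinearMap.ker δ).map φ) := by
    intro f hf
    constructor
    · intro h
      obtain ⟨m, hm, hmf⟩ := factor hq4 a w hf hw (h P₀ (by simp)) (by
        intro v hv
        by_cases hv0 : v = 0
        · rw [hv0, hzero f hf]
        · obtain ⟨p, t, ht, rfl⟩ := hvec v hv0
          rw [hsc f hf, h p, mul_zero]
          left
          have : t * eval (rep p) (linForm F a) = 0 := by
            rw [← hv, eval_linForm, eval_linForm]
            simp only [Pi.smul_apply, smul_eq_mul]
            ring
          exact (mul_eq_zero.1 this).resolve_left ht)
      exact ⟨m, by simpa [hδ] using hm, hmf⟩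
    · rintro ⟨m, hm, rfl⟩ p hp
      have hm : eval w (linForm F m) = 0 := by rw [← hδ]; exact hm
      rw [hφ, map_mul]
      rcases hp with hp | hp
      · rw [show eval (rep p) (linForm F a) = 0 from hp, zero_mul]
      · rw [show p = P₀ from hp, ← hwdef, hm, mul_zero]
  have e1 : MvPolynomial.homogeneousSubmodule (Fin 3) F 2 ⊓
      ⨅ p ∈ {p | eval (rep p) (linForm F a) = 0} ∪ {P₀},
        LinearMap.ker ((MvPolynomial.aeval (rep p)).toLinearMap)
      = (LinearMap.ker δ).map φ := by
    ext f
    rw [Submodule.mem_inf]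
    have : f ∈ (⨅ p ∈ {p | eval (rep p) (linForm F a) = 0} ∪ {P₀},
        LinearMap.ker ((MvPolynomial.aeval (R := F) (rep p)).toLinearMap)) ↔
        ∀ p ∈ {p | eval (rep p) (linForm F a) = 0} ∪ {P₀}, eval (rep p) f = 0 := by
      simp only [Submodule.mem_iInf, LinearMap.mem_ker, AlgHom.toLinearMap_apply,
        MvPolynomial.aeval_eq_eval]
    rw [this]
    constructor
    · rintro ⟨hf, h⟩
      exact (hchar f hf).1 h
    · intro h
      have hf : f.IsHomogeneous 2 := by
        obtain ⟨m, -, rfl⟩ := h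
        exact hφh m
      exact ⟨hf, (hchar f hf).2 h⟩
  have e2 : VeroneseCode rep ⊓
      vanishingOutside (({p | eval (rep p) (linForm F a) = 0} ∪ {P₀})ᶜ)
      = (LinearMap.ker δ).map (ev ∘ₗ φ) := by
    rw [Submodule.map_comp]
    ext g
    constructor
    · rintro ⟨⟨f, hf, rfl⟩, hg⟩
      refine ⟨f, (hchar f hf).1 fun p hp => ?_, rfl⟩
      rw [← hev]
      exact hg p (fun h => h hp)
    · rintro ⟨f, h, rfl⟩
      have hf : f.IsHomogeneous 2 := by
        obtain ⟨m, -, rfl⟩ := h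
        exact hφh m
      refine ⟨⟨f, hf, rfl⟩, fun p hp => ?_⟩
      rw [hev]
      exact (hchar f hf).2 h p (not_not.1 hp)
  have f2 : Module.finrank F ↥(VeroneseCode rep ⊓
      vanishingOutside (({p | eval (rep p) (linForm F a) = 0} ∪ {P₀})ᶜ)) = 2 := by
    rw [e2, ← hK]
    exact (Submodule.equivMapOfInjective _ hcinj _).finrank_eq.symm
  refine ⟨?_, f2, ?_⟩
  · rw [e1, ← hK]
    exact (Submodule.equivMapOfInjective _ hφinj _).finrank_eq.symm
  · intro Y hY
    obtain ⟨hsub, p, hpX, hpY⟩ := Set.ssubset_iff_exists.1 hY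
    have hpL : eval (rep p) (linForm F a) ≠ 0 := fun h => hpX (Or.inl h)
    have hpP : p ≠ P₀ := fun h => hpX (Or.inr h)
    obtain ⟨m, hm, hmp⟩ : ∃ m, eval w (linForm F m) = 0 ∧ eval (rep p) (linForm F m) ≠ 0 := by
      by_contra! hcon
      obtain ⟨t, ht⟩ := exists_sep w (rep p) hw0 hcon
      obtain ⟨h1, h2⟩ := hrep p
      obtain ⟨h3, h4⟩ := hrep P₀
      apply hpP
      rw [← h2, ← h4, Projectivization.mk_eq_mk_iff']
      exact ⟨t, ht⟩
    have hlt : VeroneseCode rep ⊓ vanishingOutside Y < VeroneseCode rep ⊓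
        vanishingOutside (({p | eval (rep p) (linForm F a) = 0} ∪ {P₀})ᶜ) := by
      refine SetLike.lt_iff_le_and_exists.2 ⟨?_, ev (φ m), ?_, ?_⟩
      · rintro g ⟨h1, h2⟩
        exact ⟨h1, fun p hp => h2 p fun h => hp (hsub h)⟩
      · rw [e2]
        exact ⟨m, (hδ m).trans hm, rfl⟩
      · rintro ⟨-, h⟩
        have := h p hpY
        rw [hev, hφ, map_mul] at this
        exact (mul_ne_zero hpL hmp) this
    have : FiniteDimensional F ↥(VeroneseCode rep ⊓
      vanishingOutside (({p | eval (rep p) (linForm F a) = 0} ∪ {P₀})ᶜ)) :=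
      Module.finite_of_finrank_pos (by rw [f2]; norm_num)
    have := Submodule.finrank_lt_finrank_of_lt hlt
    omega
end
end

section
/- Let q ≥ 4 be a prime power and let T ⊆ P be a set of 4 points no three of which are collinear. Then the F-vector space of homogeneous degree-2 polynomials f ∈ F[x_0,x_1,x_2] satisfying f(rep p) = 0 for all p ∈ T has dimension 2; equivalently, dim_F {c ∈ C_q : supp(c) ⊆ P ∖ T} = 2. Moreover X = P ∖ T is inclusion-minimal with this property: every proper subset Y ⊊ X satisfies dim_F {c ∈ C_q : supp(c) ⊆ Y} ≤ 1. -/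
noncomputable section

open MvPolynomial

/-- Explicit shape of a ternary quadratic form. -/
theorem quad_form {F : Type*} [Field F] (f : MvPolynomial (Fin 3) F)
    (hf : f ∈ homogeneousSubmodule (Fin 3) F 2) :
    ∃ a b c d e k : F, f = C a * X 0 ^ 2 + C b * X 1 ^ 2 + C c * X 2 ^ 2 +
      C d * (X 0 * X 1) + C e * (X 0 * X 2) + C k * (X 1 * X 2) := by
  rw [mem_homogeneousSubmodule] at hf
  rw [f.as_sum]
  refine Finset.sum_induction _ (fun g => ∃ a b c d e k : F, g = C a * X 0 ^ 2 + C b * X 1 ^ 2 +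
    C c * X 2 ^ 2 + C d * (X 0 * X 1) + C e * (X 0 * X 2) + C k * (X 1 * X 2)) ?_ ?_ ?_
  · rintro g h ⟨a, b, c, d, e, k, rfl⟩ ⟨a', b', c', d', e', k', rfl⟩
    refine ⟨a + a', b + b', c + c', d + d', e + e', k + k', ?_⟩
    simp only [C_add]
    ring
  · exact ⟨0, 0, 0, 0, 0, 0, by simp⟩
  · intro m hm
    have hdeg := hf (mem_support_iff.mp hm)
    generalize coeff m f = t
    have hsum : m 0 + m 1 + m 2 = 2 := by
      rw [Finsupp.weight_apply, Finsupp.sum_fintype _ _ (by simp)] at hdeg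
      simpa [Fin.sum_univ_three] using hdeg
    have hmon : monomial m t = C t * (X 0 ^ m 0 * X 1 ^ m 1 * X 2 ^ m 2) := by
      rw [monomial_eq, Finsupp.prod_fintype _ _ (by simp), Fin.prod_univ_three]
    rw [hmon]
    have h0 : m 0 ≤ 2 := by omega
    have h1 : m 1 ≤ 2 := by omega
    generalize m 0 = i at *
    generalize m 1 = j at *
    generalize m 2 = l at *
    interval_cases i <;> interval_cases j
    · obtain rfl : l = 2 := by omega
      exact ⟨0, 0, t, 0, 0, 0, by simp⟩
    · obtain rfl : l = 1 := by omega
      exact ⟨0, 0, 0, 0, 0, t, by simp⟩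
    · obtain rfl : l = 0 := by omega
      exact ⟨0, t, 0, 0, 0, 0, by simp⟩
    · obtain rfl : l = 1 := by omega
      exact ⟨0, 0, 0, 0, t, 0, by simp⟩
    · obtain rfl : l = 0 := by omega
      exact ⟨0, 0, 0, t, 0, 0, by simp⟩
    · omega
    · obtain rfl : l = 0 := by omega
      exact ⟨t, 0, 0, 0, 0, 0, by simp⟩
    · omega
    · omega

theorem quad_eq_zero {F : Type*} [Field F] (f : MvPolynomial (Fin 3) F)
    (hf : f ∈ homogeneousSubmodule (Fin 3) F 2) (h : ∀ x : Fin 3 → F, aeval x f = 0) :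
    f = 0 := by
  obtain ⟨a, b, c, d, e, k, rfl⟩ := quad_form f hf
  have h1 := h ![1, 0, 0]
  have h2 := h ![0, 1, 0]
  have h3 := h ![0, 0, 1]
  have h4 := h ![1, 1, 0]
  have h5 := h ![1, 0, 1]
  have h6 := h ![0, 1, 1]
  simp at h1 h2 h3
  subst h1 h2 h3
  simp at h4 h5 h6
  simp [h4, h5, h6]

theorem quad_expand {F : Type*} [Field F] (f : MvPolynomial (Fin 3) F)
    (hf : f ∈ homogeneousSubmodule (Fin 3) F 2) (u v w : Fin 3 → F) (x y z : F) :
    aeval (x • u + y • v + z • w) f = x ^ 2 * aeval u f + y ^ 2 * aeval v f + z ^ 2 * aeval w f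
      + x * y * (aeval (u + v) f - aeval u f - aeval v f)
      + x * z * (aeval (u + w) f - aeval u f - aeval w f)
      + y * z * (aeval (v + w) f - aeval v f - aeval w f) := by
  obtain ⟨a, b, c, d, e, k, rfl⟩ := quad_form f hf
  simp
  ring

theorem quad_smul {F : Type*} [Field F] (f : MvPolynomial (Fin 3) F)
    (hf : f ∈ homogeneousSubmodule (Fin 3) F 2) (u : Fin 3 → F) (x : F) :
    aeval (x • u) f = x ^ 2 * aeval u f := by
  obtain ⟨a, b, c, d, e, k, rfl⟩ := quad_form f hf
  simp
  ring

/-- The determinant of three vectors. -/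
def det3 {F : Type*} [Field F] (u v w : Fin 3 → F) : F :=
  (u 1 * v 2 - u 2 * v 1) * w 0 + (u 2 * v 0 - u 0 * v 2) * w 1 + (u 0 * v 1 - u 1 * v 0) * w 2

/-- The linear form of the line through two points. -/
def lineForm {F : Type*} [Field F] (u v : Fin 3 → F) : MvPolynomial (Fin 3) F :=
  C (u 1 * v 2 - u 2 * v 1) * X 0 + C (u 2 * v 0 - u 0 * v 2) * X 1 +
    C (u 0 * v 1 - u 1 * v 0) * X 2

theorem lineForm_eval {F : Type*} [Field F] (u v w : Fin 3 → F) :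
    aeval w (lineForm u v) = det3 u v w := by
  simp [lineForm, det3]

theorem lineForm_hom {F : Type*} [Field F] (u v : Fin 3 → F) :
    (lineForm u v).IsHomogeneous 1 := by
  unfold lineForm
  refine ((?_ : IsHomogeneous _ _).add ?_).add ?_ <;> exact isHomogeneous_C_mul_X _ _

theorem det3_ne {F : Type*} [Field F] {u v w : Fin 3 → F} (h : LinearIndependent F ![u, v, w]) :
    det3 u v w ≠ 0 := by
  have h2 := (Matrix.linearIndependent_rows_iff_isUnit (A := Matrix.of ![u, v, w])).mp h
  rw [Matrix.isUnit_iff_isUnit_det, isUnit_iff_ne_zero] at h2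
  intro h0
  apply h2
  rw [← h0, Matrix.det_fin_three]
  simp [det3]
  ring

theorem det3_cramer {F : Type*} [Field F] (u v w x : Fin 3 → F) :
    det3 u v w • x = det3 v w x • u + (- det3 u w x) • v + det3 u v x • w := by
  ext i
  fin_cases i <;> simp [det3] <;> ring

theorem exists_coords {F : Type*} [Field F] {u v w : Fin 3 → F} (h : det3 u v w ≠ 0)
    (x : Fin 3 → F) : x = ((det3 u v w)⁻¹ * det3 v w x) • u +
      ((det3 u v w)⁻¹ * (- det3 u w x)) • v + ((det3 u v w)⁻¹ * det3 u v x) • w := by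
  simp only [mul_smul, ← smul_add]
  rw [← det3_cramer, smul_smul, inv_mul_cancel₀ h, one_smul]

theorem quad_det_zero {F : Type*} [Field F] {u v w t : Fin 3 → F} (h : det3 u v w ≠ 0)
    (h2 : det3 v w t ≠ 0) (h3 : det3 u w t ≠ 0) (f : MvPolynomial (Fin 3) F)
    (hf : f ∈ homogeneousSubmodule (Fin 3) F 2)
    (fu : aeval u f = 0) (fv : aeval v f = 0) (fw : aeval w f = 0) (ft : aeval t f = 0)
    (fuv : aeval (u + v) f = 0)
    (fuw : aeval (u + w) f = 0) (h4 : det3 u v t ≠ 0) : f = 0 := by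
  have e := quad_expand f hf u v w
  simp only [fu, fv, fw, fuv, fuw] at e
  have e1 := e ((det3 u v w)⁻¹ * det3 v w t) ((det3 u v w)⁻¹ * (- det3 u w t))
    ((det3 u v w)⁻¹ * det3 u v t)
  rw [← exists_coords h t, ft] at e1
  have : aeval (v + w) f = 0 := by simpa [h, h2, h3, h4] using e1
  apply quad_eq_zero f hf
  intro x
  rw [exists_coords h x, e, this]
  ring

theorem veronese_quadrilateral_nullity_two
    {F : Type*} [Field F] [Fintype F] (q : ℕ) (hq : Fintype.card F = q) (hq4 : 4 ≤ q)
    (rep : Plane F → (Fin 3 → F))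
    (hrep : ∀ p : Plane F, ∃ h : rep p ≠ 0, Projectivization.mk F (rep p) h = p)
    (T : Set (Plane F)) (hT : T.ncard = 4)
    (hcol : ∀ p₁ ∈ T, ∀ p₂ ∈ T, ∀ p₃ ∈ T, p₁ ≠ p₂ → p₁ ≠ p₃ → p₂ ≠ p₃ →
      LinearIndependent F ![rep p₁, rep p₂, rep p₃]) :
    Module.finrank F ↥(MvPolynomial.homogeneousSubmodule (Fin 3) F 2 ⊓
      ⨅ p ∈ T, LinearMap.ker ((MvPolynomial.aeval (rep p)).toLinearMap)) = 2 ∧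
    Module.finrank F ↥(VeroneseCode rep ⊓ vanishingOutside Tᶜ) = 2 ∧
    ∀ Y : Set (Plane F), Y ⊂ Tᶜ →
      Module.finrank F ↥(VeroneseCode rep ⊓ vanishingOutside Y) ≤ 1 := by
  classical
  -- injectivity of the evaluation
  have hinj : ∀ f ∈ homogeneousSubmodule (Fin 3) F 2, (∀ p, aeval (rep p) f = 0) → f = 0 := by
    intro f hf h
    apply quad_eq_zero f hf
    intro x
    by_cases hx : x = 0
    · have := quad_smul f hf x 0
      simpa [hx] using this
    · obtain ⟨h0, h1⟩ := hrep (Projectivization.mk F x hx)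
      rw [Projectivization.mk_eq_mk_iff'] at h1
      obtain ⟨a, ha⟩ := h1
      have h2 := h (Projectivization.mk F x hx)
      rw [← ha, quad_smul f hf] at h2
      rcases mul_eq_zero.mp h2 with h3 | h3
      · have : a = 0 := by simpa using h3
        rw [this, zero_smul] at ha
        exact absurd ha.symm h0
      · exact h3
  set ev : MvPolynomial (Fin 3) F →ₗ[F] (Plane F → F) :=
    LinearMap.pi fun p => (MvPolynomial.aeval (rep p)).toLinearMap with hev
  have evapp : ∀ f p, ev f p = aeval (rep p) f := fun f p => rfl
  let W : Set (Plane F) → Submodule F (MvPolynomial (Fin 3) F) := fun S =>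
    homogeneousSubmodule (Fin 3) F 2 ⊓
      ⨅ p ∈ S, LinearMap.ker ((MvPolynomial.aeval (rep p)).toLinearMap)
  have memW : ∀ S f, f ∈ W S ↔ f ∈ homogeneousSubmodule (Fin 3) F 2 ∧
      ∀ p ∈ S, aeval (rep p) f = 0 := by
    intro S f
    simp only [W, Submodule.mem_inf, Submodule.mem_iInf, LinearMap.mem_ker,
      AlgHom.toLinearMap_apply]
  have code : ∀ Y : Set (Plane F),
      Module.finrank F ↥(VeroneseCode rep ⊓ vanishingOutside Y) = Module.finrank F ↥(W Yᶜ) := by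
    intro Y
    have hr : LinearMap.range (ev.domRestrict (W Yᶜ)) = VeroneseCode rep ⊓ vanishingOutside Y := by
      ext g
      constructor
      · rintro ⟨⟨f, hf⟩, rfl⟩
        rw [memW] at hf
        exact ⟨⟨f, hf.1, rfl⟩, fun p hp => hf.2 p hp⟩
      · rintro ⟨⟨f, hf, rfl⟩, h2⟩
        exact ⟨⟨f, (memW _ _).2 ⟨hf, fun p hp => h2 p hp⟩⟩, rfl⟩
    rw [← hr]
    apply LinearMap.finrank_range_of_inj
    rw [← LinearMap.ker_eq_bot, LinearMap.ker_eq_bot']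
    rintro ⟨f, hf⟩ h
    apply Subtype.ext
    exact hinj f ((memW _ _).1 hf).1 (fun p => congrFun h p)
  -- the four points
  obtain ⟨p₁, p₂, p₃, p₄, n12, n13, n14, n23, n24, n34, rfl⟩ := Set.ncard_eq_four.mp hT
  have d123 := det3_ne (hcol p₁ (by simp) p₂ (by simp) p₃ (by simp) n12 n13 n23)
  have d124 := det3_ne (hcol p₁ (by simp) p₂ (by simp) p₄ (by simp) n12 n14 n24)
  have d134 := det3_ne (hcol p₁ (by simp) p₃ (by simp) p₄ (by simp) n13 n14 n34)
  have d234 := det3_ne (hcol p₂ (by simp) p₃ (by simp) p₄ (by simp) n23 n24 n34)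
  set T : Set (Plane F) := {p₁, p₂, p₃, p₄} with hTdef
  -- upper bound
  let φ : MvPolynomial (Fin 3) F →ₗ[F] (Fin 2 → F) :=
    LinearMap.pi ![(aeval (rep p₁ + rep p₂)).toLinearMap, (aeval (rep p₁ + rep p₃)).toLinearMap]
  have φinj : Function.Injective (φ.domRestrict (W T)) := by
    rw [← LinearMap.ker_eq_bot, LinearMap.ker_eq_bot']
    rintro ⟨f, hf⟩ h
    apply Subtype.ext
    rw [memW] at hf
    exact quad_det_zero d123 d234 d134 f hf.1 (hf.2 _ (by simp [hTdef]))
      (hf.2 _ (by simp [hTdef])) (hf.2 _ (by simp [hTdef])) (hf.2 _ (by simp [hTdef]))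
      (congrFun h 0) (congrFun h 1) d124
  haveI : Module.Finite F (W T) := Module.Finite.of_injective _ φinj
  have upper : Module.finrank F (W T) ≤ 2 := by
    simpa using LinearMap.finrank_le_finrank_of_injective φinj
  -- two conics
  have fmem : ∀ a b c d : Fin 3 → F,
      lineForm a b * lineForm c d ∈ homogeneousSubmodule (Fin 3) F 2 := fun a b c d =>
    (lineForm_hom a b).mul (lineForm_hom c d)
  have feval : ∀ a b c d x : Fin 3 → F,
      aeval x (lineForm a b * lineForm c d) = det3 a b x * det3 c d x := fun a b c d x => by
    rw [map_mul, lineForm_eval, lineForm_eval]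
  have f1 : lineForm (rep p₁) (rep p₂) * lineForm (rep p₃) (rep p₄) ∈ W T := by
    rw [memW]
    refine ⟨fmem _ _ _ _, ?_⟩
    intro p hp
    rw [feval]
    rcases hp with rfl | rfl | rfl | rfl <;> simp only [det3] <;> ring
  have f2 : lineForm (rep p₁) (rep p₃) * lineForm (rep p₂) (rep p₄) ∈ W T := by
    rw [memW]
    refine ⟨fmem _ _ _ _, ?_⟩
    intro p hp
    rw [feval]
    rcases hp with rfl | rfl | rfl | rfl <;> simp only [det3] <;> ring
  have lower : 2 ≤ Module.finrank F (W T) := by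
    have hli : LinearIndependent F ![(⟨_, f1⟩ : W T), ⟨_, f2⟩] := by
      rw [LinearIndependent.pair_iff]
      intro s t hst
      have hst' := congrArg Subtype.val hst
      simp only [Submodule.coe_add, Submodule.coe_smul, Submodule.coe_zero] at hst'
      have key : ∀ x, s * (det3 (rep p₁) (rep p₂) x * det3 (rep p₃) (rep p₄) x) +
          t * (det3 (rep p₁) (rep p₃) x * det3 (rep p₂) (rep p₄) x) = 0 := by
        intro x
        have := congrArg (aeval x) hst'
        simpa only [map_add, map_smul, feval, map_zero, smul_eq_mul] using this
      constructor
      · have h := key (rep p₁ + rep p₃)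
        have : s * (det3 (rep p₁) (rep p₂) (rep p₃) * det3 (rep p₁) (rep p₃) (rep p₄)) = 0 := by
          rw [← h]; simp only [det3, Pi.add_apply]; ring
        simpa [d123, d134] using this
      · have h := key (rep p₁ + rep p₂)
        have : t * (det3 (rep p₁) (rep p₂) (rep p₃) * det3 (rep p₁) (rep p₂) (rep p₄)) = 0 := by
          rw [← neg_eq_zero, ← h]; simp only [det3, Pi.add_apply]; ring
        simpa [d123, d124] using this
    simpa using hli.fintype_card_le_finrank
  have dimW : Module.finrank F (W T) = 2 := le_antisymm upper lower
  refine ⟨dimW, ?_, ?_⟩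
  · rw [code, compl_compl, dimW]
  intro Y hY
  rw [code]
  obtain ⟨p, hpT, hpY⟩ := Set.exists_of_ssubset hY
  have hle : W Yᶜ ≤ W T := by
    intro f hf
    rw [memW] at hf ⊢
    exact ⟨hf.1, fun p hp => hf.2 p (fun h => hY.1 h hp)⟩
  have hlt : W Yᶜ < W T := by
    refine lt_of_le_of_ne hle ?_
    intro heq
    have g1 := ((memW _ _).1 (heq ▸ f1)).2 p hpY
    have g2 := ((memW _ _).1 (heq ▸ f2)).2 p hpY
    rw [feval] at g1 g2
    -- two lines through a common vertex meet only there
    have meet : ∀ a ∈ T, ∀ v w, det3 (rep a) v w ≠ 0 → det3 (rep a) v (rep p) = 0 →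
        det3 (rep a) w (rep p) = 0 → False := by
      intro a ha v w hd h1 h2
      have hx := exists_coords hd (rep p)
      rw [h1, h2] at hx
      simp only [neg_zero, mul_zero, zero_smul, add_zero] at hx
      obtain ⟨hp0, hp1⟩ := hrep p
      obtain ⟨ha0, ha1⟩ := hrep a
      have : p = a := by
        rw [← hp1, ← ha1, Projectivization.mk_eq_mk_iff']
        exact ⟨_, hx.symm⟩
      exact hpT (this ▸ ha)
    have sw : ∀ a b c : Fin 3 → F, det3 a b c = - det3 b a c := by
      intro a b c; simp only [det3]; ring
    have cyc : ∀ a b c : Fin 3 → F, det3 a b c = det3 b c a := by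
      intro a b c; simp only [det3]; ring
    rcases mul_eq_zero.mp g1 with h | h <;> rcases mul_eq_zero.mp g2 with h' | h'
    · exact meet p₁ (by simp [hTdef]) _ _ d123 h h'
    · refine meet p₂ (by simp [hTdef]) (rep p₁) (rep p₄) ?_ ?_ h'
      · rw [sw]; simpa using d124
      · rw [sw]; simpa using h
    · refine meet p₃ (by simp [hTdef]) (rep p₄) (rep p₁) ?_ h ?_
      · rw [← cyc]; exact d134
      · rw [sw]; simpa using h'
    · refine meet p₄ (by simp [hTdef]) (rep p₂) (rep p₃) ?_ ?_ ?_
      · rw [cyc]; exact d234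
      · rw [sw]; simpa using h'
      · rw [sw]; simpa using h
  have := Submodule.finrank_lt_finrank_of_lt hlt
  omega
end
end

section
/- Let q ≥ 4 be a prime power. The number of 4-element subsets of the projective plane P over F in which no three points are collinear (quadrilateral configurations) equals (q^2+q+1)·q^2·(q^2+q)·(q−1)^2/24. -/
noncomputable section

/-- the explicit 3 by 3 determinant with rows `a, b, c` -/
def qcDet {F : Type*} [Field F] (a b c : Fin 3 → F) : F :=
  a 0 * b 1 * c 2 - a 0 * b 2 * c 1 - a 1 * b 0 * c 2 + a 1 * b 2 * c 0
    + a 2 * b 0 * c 1 - a 2 * b 1 * c 0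

theorem qc_li_iff {F : Type*} [Field F] (a b c : Fin 3 → F) :
    LinearIndependent F ![a, b, c] ↔ qcDet a b c ≠ 0 := by
  have h := Matrix.linearIndependent_rows_iff_isUnit (K := F) (A := Matrix.of ![a, b, c])
  rw [Matrix.isUnit_iff_isUnit_det, isUnit_iff_ne_zero, Matrix.det_fin_three] at h
  exact h

/-- any three vectors of the quadruple are independent -/
def QcGood {F : Type*} [Field F] (w : Fin 4 → Fin 3 → F) : Prop :=
  ∀ i j k, i ≠ j → i ≠ k → j ≠ k → LinearIndependent F ![w i, w j, w k]

theorem qc_smul_iff {F : Type*} [Field F] (w : Fin 4 → Fin 3 → F) (u : Fin 4 → Fˣ) :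
    QcGood (fun i => (u i : F) • w i) ↔ QcGood w := by
  unfold QcGood
  refine forall_congr' fun i => forall_congr' fun j => forall_congr' fun k => ?_
  refine imp_congr_right fun _ => imp_congr_right fun _ => imp_congr_right fun _ => ?_
  rw [qc_li_iff, qc_li_iff]
  have : qcDet ((u i : F) • w i) ((u j : F) • w j) ((u k : F) • w k)
      = (u i : F) * u j * u k * qcDet (w i) (w j) (w k) := by
    simp [qcDet]; ring
  rw [this]
  simp

theorem qc_inj {F : Type*} [Field F] (f : Fin 4 → Plane F)
    (h : QcGood (fun i => (f i).rep)) : Function.Injective f := by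
  intro i j hij
  by_contra hne
  obtain ⟨k, hik, hjk⟩ : ∃ k : Fin 4, i ≠ k ∧ j ≠ k := by
    clear hij h; revert i j; decide
  have h1 := (h i j k hne hik hjk).injective
  have : (0 : Fin 3) = 1 := h1 (by simp [hij])
  exact absurd this (by decide)

theorem qc_card_sets {F : Type*} [Field F] [Fintype F] :
    Nat.card {f : Fin 4 → Plane F // QcGood (fun i => (f i).rep)} =
    Nat.card {T : Set (Plane F) // T.ncard = 4 ∧
        ∀ p₁ ∈ T, ∀ p₂ ∈ T, ∀ p₃ ∈ T, p₁ ≠ p₂ → p₁ ≠ p₃ → p₂ ≠ p₃ →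
          LinearIndependent F ![p₁.rep, p₂.rep, p₃.rep]} * 24 := by
  classical
  set S := {T : Set (Plane F) // T.ncard = 4 ∧
        ∀ p₁ ∈ T, ∀ p₂ ∈ T, ∀ p₃ ∈ T, p₁ ≠ p₂ → p₁ ≠ p₃ → p₂ ≠ p₃ →
          LinearIndependent F ![p₁.rep, p₂.rep, p₃.rep]} with hS
  have : Finite (Plane F) := inferInstance
  have : Fintype S := Fintype.ofFinite _
  have e : (Σ T : S, (Fin 4 ≃ T.1)) ≃ {f : Fin 4 → Plane F // QcGood (fun i => (f i).rep)} := by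
    refine Equiv.ofBijective (fun x => ⟨fun i => (x.2 i : Plane F), ?_⟩) ⟨?_, ?_⟩
    · intro i j k hij hik hjk
      refine x.1.2.2 _ (x.2 i).2 _ (x.2 j).2 _ (x.2 k).2 ?_ ?_ ?_ <;>
      · intro h
        have := x.2.injective (Subtype.ext h)
        contradiction
    · rintro ⟨⟨T, hT⟩, e⟩ ⟨⟨T', hT'⟩, e'⟩ h
      have h1 : ∀ i, (e i : Plane F) = e' i := fun i => congrFun (congrArg Subtype.val h) i
      have hTT : T = T' := by
        ext p
        constructor
        · intro hp
          have := h1 (e.symm ⟨p, hp⟩)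
          simp only [Equiv.apply_symm_apply] at this
          rw [this]; exact (e' _).2
        · intro hp
          have := h1 (e'.symm ⟨p, hp⟩)
          simp only [Equiv.apply_symm_apply] at this
          rw [← this]; exact (e _).2
      subst hTT
      have : e = e' := Equiv.ext fun i => Subtype.ext (h1 i)
      subst this
      rfl
    · rintro ⟨f, hf⟩
      have hi := qc_inj f hf
      refine ⟨⟨⟨Set.range f, ?_, ?_⟩, Equiv.ofInjective f hi⟩, ?_⟩
      · rw [← Set.image_univ, Set.ncard_image_of_injective _ hi]
        simp [Set.ncard_univ]
      · rintro _ ⟨i, rfl⟩ _ ⟨j, rfl⟩ _ ⟨k, rfl⟩ h1 h2 h3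
        exact hf i j k (fun h => h1 (h ▸ rfl)) (fun h => h2 (h ▸ rfl)) (fun h => h3 (h ▸ rfl))
      · rfl
  rw [← Nat.card_congr e, Nat.card_sigma]
  have : ∀ T : S, Nat.card (Fin 4 ≃ T.1) = 24 := by
    intro T
    have : Fintype T.1 := Fintype.ofFinite _
    have h4 : Fintype.card T.1 = 4 := by
      rw [← Nat.card_eq_fintype_card]; exact T.2.1
    have e0 : Fin 4 ≃ T.1 := Fintype.equivOfCardEq (by simp [h4])
    rw [Nat.card_eq_fintype_card, Fintype.card_equiv e0]
    rfl
  simp [this]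

theorem qc_card_rep {F : Type*} [Field F] [Fintype F] :
    Nat.card {w : Fin 4 → Fin 3 → F // QcGood w} =
    Nat.card {f : Fin 4 → Plane F // QcGood (fun i => (f i).rep)} * Nat.card (Fin 4 → Fˣ) := by
  classical
  rw [← Nat.card_prod]
  symm
  refine Nat.card_congr (Equiv.ofBijective
    (fun x => ⟨fun i => (x.2 i : F) • (x.1.1 i).rep, (qc_smul_iff _ _).2 x.1.2⟩) ⟨?_, ?_⟩)
  · rintro ⟨⟨f, hf⟩, u⟩ ⟨⟨g, hg⟩, v⟩ h
    have h1 : ∀ i, (u i : F) • (f i).rep = (v i : F) • (g i).rep :=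
      fun i => congrFun (congrArg Subtype.val h) i
    have hfg : f = g := by
      funext i
      rw [← (f i).mk_rep, ← (g i).mk_rep, Projectivization.mk_eq_mk_iff]
      refine ⟨(u i)⁻¹ * v i, ?_⟩
      rw [mul_smul, inv_smul_eq_iff]
      exact (h1 i).symm
    subst hfg
    have : u = v := by
      funext i
      exact Units.ext (smul_left_injective F (f i).rep_nonzero (h1 i))
    subst this
    rfl
  · rintro ⟨w, hw⟩
    have hw0 : ∀ i, w i ≠ 0 := by
      intro i
      obtain ⟨j, k, hij, hik, hjk⟩ : ∃ j k : Fin 4, i ≠ j ∧ i ≠ k ∧ j ≠ k := by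
        revert i; decide
      exact (hw i j k hij hik hjk).ne_zero 0
    choose a ha using fun i => Projectivization.exists_smul_eq_mk_rep F (w i) (hw0 i)
    have hwa : (fun i => ((a⁻¹ : Fin 4 → Fˣ) i : F) • (Projectivization.mk F (w i) (hw0 i)).rep) = w := by
      funext i
      rw [← ha i]
      exact inv_smul_smul (a i) (w i)
    refine ⟨⟨⟨fun i => Projectivization.mk F (w i) (hw0 i), ?_⟩, a⁻¹⟩, Subtype.ext hwa⟩
    rw [← qc_smul_iff _ (a⁻¹), hwa]
    exact hw

theorem qc_good_of {F : Type*} [Field F] (v : Fin 3 → Fin 3 → F) (hv : LinearIndependent F v)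
    (c : Fin 3 → Fˣ) :
    QcGood ![v 0, v 1, v 2, (c 0 : F) • v 0 + (c 1 : F) • v 1 + (c 2 : F) • v 2] := by
  have hD : qcDet (v 0) (v 1) (v 2) ≠ 0 := by
    rw [← qc_li_iff]
    convert hv using 1
    funext i; fin_cases i <;> rfl
  set w := ![v 0, v 1, v 2, (c 0 : F) • v 0 + (c 1 : F) • v 1 + (c 2 : F) • v 2] with hw
  have key : ∀ x y z : Fin 4, LinearIndependent F ![w x, w y, w z] →
      LinearIndependent F ![w y, w x, w z] ∧ LinearIndependent F ![w x, w z, w y] := by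
    intro x y z h
    rw [qc_li_iff] at h ⊢
    rw [qc_li_iff]
    constructor
    · intro h0; apply h
      unfold qcDet at h0 ⊢
      linear_combination - h0
    · intro h0; apply h
      unfold qcDet at h0 ⊢
      linear_combination - h0
  have h012 : LinearIndependent F ![w 0, w 1, w 2] := (qc_li_iff _ _ _).2 hD
  have h013 : LinearIndependent F ![w 0, w 1, w 3] := by
    rw [qc_li_iff]
    have : qcDet (w 0) (w 1) (w 3) = (c 2 : F) * qcDet (v 0) (v 1) (v 2) := by
      simp [qcDet, hw]; ring
    rw [this]; exact mul_ne_zero (c 2).ne_zero hD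
  have h023 : LinearIndependent F ![w 0, w 2, w 3] := by
    rw [qc_li_iff]
    have : qcDet (w 0) (w 2) (w 3) = -((c 1 : F) * qcDet (v 0) (v 1) (v 2)) := by
      simp [qcDet, hw]; ring
    rw [this]; exact neg_ne_zero.2 (mul_ne_zero (c 1).ne_zero hD)
  have h123 : LinearIndependent F ![w 1, w 2, w 3] := by
    rw [qc_li_iff]
    have : qcDet (w 1) (w 2) (w 3) = (c 0 : F) * qcDet (v 0) (v 1) (v 2) := by
      simp [qcDet, hw]; ring
    rw [this]; exact mul_ne_zero (c 0).ne_zero hD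
  have all : ∀ x y z : Fin 4, LinearIndependent F ![w x, w y, w z] →
      LinearIndependent F ![w x, w z, w y] ∧ LinearIndependent F ![w y, w x, w z] ∧
      LinearIndependent F ![w y, w z, w x] ∧ LinearIndependent F ![w z, w x, w y] ∧
      LinearIndependent F ![w z, w y, w x] := by
    intro x y z h
    have a1 := (key _ _ _ h).2
    have a2 := (key _ _ _ h).1
    have a3 := (key _ _ _ a2).2
    have a4 := (key _ _ _ a1).1
    exact ⟨a1, a2, a3, a4, (key _ _ _ a4).2⟩
  clear_value w
  obtain ⟨a1, a2, a3, a4, a5⟩ := all _ _ _ h012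
  obtain ⟨b1, b2, b3, b4, b5⟩ := all _ _ _ h013
  obtain ⟨c1, c2, c3, c4, c5⟩ := all _ _ _ h023
  obtain ⟨d1, d2, d3, d4, d5⟩ := all _ _ _ h123
  intro i j k hij hik hjk
  fin_cases i <;> fin_cases j <;> first | exact absurd rfl hij | skip
  all_goals fin_cases k <;>
    first | exact absurd rfl hik | exact absurd rfl hjk | assumption

theorem qc_card_li {F : Type*} [Field F] [Fintype F] :
    Nat.card {w : Fin 4 → Fin 3 → F // QcGood w} =
    Nat.card {v : Fin 3 → Fin 3 → F // LinearIndependent F v} * Nat.card (Fin 3 → Fˣ) := by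
  classical
  rw [← Nat.card_prod]
  symm
  refine Nat.card_congr (Equiv.ofBijective
    (fun x => ⟨_, qc_good_of x.1.1 x.1.2 x.2⟩) ⟨?_, ?_⟩)
  · rintro ⟨⟨f, hf⟩, u⟩ ⟨⟨g, hg⟩, v⟩ h
    have h1 := congrArg Subtype.val h
    have hfg : f = g := by
      funext i
      fin_cases i
      · exact congrFun h1 0
      · exact congrFun h1 1
      · exact congrFun h1 2
    subst hfg
    have h3 : (u 0 : F) • f 0 + (u 1 : F) • f 1 + (u 2 : F) • f 2
      = (v 0 : F) • f 0 + (v 1 : F) • f 1 + (v 2 : F) • f 2 := congrFun h1 3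
    have : u = v := by
      have h4 := Fintype.linearIndependent_iff.1 hf (fun i => (u i : F) - v i) (by
        rw [Fin.sum_univ_three]
        simp only [sub_smul]
        rw [← sub_eq_zero] at h3
        rw [← h3]; abel)
      funext i
      exact Units.ext (sub_eq_zero.1 (h4 i))
    subst this
    rfl
  · rintro ⟨w, hw⟩
    have h012 := hw 0 1 2 (by decide) (by decide) (by decide)
    have hD := (qc_li_iff _ _ _).1 h012
    have h0 := (qc_li_iff _ _ _).1 (hw 3 1 2 (by decide) (by decide) (by decide))
    have h1 := (qc_li_iff _ _ _).1 (hw 0 3 2 (by decide) (by decide) (by decide))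
    have h2 := (qc_li_iff _ _ _).1 (hw 0 1 3 (by decide) (by decide) (by decide))
    have hc : w 3 = (qcDet (w 3) (w 1) (w 2) / qcDet (w 0) (w 1) (w 2)) • w 0
        + (qcDet (w 0) (w 3) (w 2) / qcDet (w 0) (w 1) (w 2)) • w 1
        + (qcDet (w 0) (w 1) (w 3) / qcDet (w 0) (w 1) (w 2)) • w 2 := by
      funext i
      simp only [Pi.add_apply, Pi.smul_apply, smul_eq_mul]
      rw [div_mul_eq_mul_div, div_mul_eq_mul_div, div_mul_eq_mul_div, ← add_div, ← add_div,
        eq_div_iff hD]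
      simp only [qcDet]
      fin_cases i <;> simp <;> ring
    refine ⟨⟨⟨![w 0, w 1, w 2], h012⟩, ![Units.mk0 _ (div_ne_zero h0 hD),
      Units.mk0 _ (div_ne_zero h1 hD), Units.mk0 _ (div_ne_zero h2 hD)]⟩, ?_⟩
    apply Subtype.ext
    funext i
    fin_cases i
    · rfl
    · rfl
    · rfl
    · exact hc.symm

theorem card_quadrilateral_configurations
    {F : Type*} [Field F] [Fintype F] (q : ℕ) (hq : Fintype.card F = q) (hq4 : 4 ≤ q) :
    (Nat.card {T : Set (Plane F) // T.ncard = 4 ∧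
        ∀ p₁ ∈ T, ∀ p₂ ∈ T, ∀ p₃ ∈ T, p₁ ≠ p₂ → p₁ ≠ p₃ → p₂ ≠ p₃ →
          LinearIndependent F ![p₁.rep, p₂.rep, p₃.rep]} : ℚ) =
      ((q : ℚ) ^ 2 + q + 1) * q ^ 2 * (q ^ 2 + q) * (q - 1) ^ 2 / 24 := by
  have e1 := qc_card_sets (F := F)
  have e2 := qc_card_rep (F := F)
  have e3 := qc_card_li (F := F)
  have e4 := card_linearIndependent (K := F) (V := Fin 3 → F) (k := 3) (by simp)
  have hu : Nat.card Fˣ = q - 1 := by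
    classical
    rw [Nat.card_eq_fintype_card, Fintype.card_units, hq]
  rw [e3, e1] at e2
  rw [e4] at e2
  simp only [Nat.card_fun, hu, Nat.card_eq_fintype_card (α := Fin _), Fintype.card_fin,
    Module.finrank_fin_fun, Fin.prod_univ_three, hq] at e2
  generalize Nat.card _ = N at e2 ⊢
  obtain ⟨m, rfl⟩ : ∃ m, q = m + 1 := ⟨q - 1, by omega⟩
  have hm : (m : ℚ) ≠ 0 := by
    have : m ≠ 0 := by omega
    exact_mod_cast this
  have l1 : (m + 1) ^ ((0 : Fin 3) : ℕ) ≤ (m + 1) ^ 3 := Nat.pow_le_pow_right (by omega) (by simp)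
  have l2 : (m + 1) ^ ((1 : Fin 3) : ℕ) ≤ (m + 1) ^ 3 := Nat.pow_le_pow_right (by omega) (by simp)
  have l3 : (m + 1) ^ ((2 : Fin 3) : ℕ) ≤ (m + 1) ^ 3 := Nat.pow_le_pow_right (by omega) (by simp)
  have e5 := congrArg (Nat.cast : ℕ → ℚ) e2
  rw [Nat.add_sub_cancel] at e5
  push_cast [Nat.cast_sub l1, Nat.cast_sub l2, Nat.cast_sub l3] at e5
  push_cast
  apply mul_right_cancel₀ (pow_ne_zero 4 hm)
  simp at e5
  linear_combination (-1 / 24 : ℚ) * e5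
end
end

section
/- Let q ≥ 4 be a prime power, let L ⊆ P be a line, let P_0 ∈ P ∖ L, and set S = P ∖ (L ∪ {P_0}), a set of q^2−1 points. Call a subset Y ⊆ P dependent if there exists a nonzero codeword c ∈ C_q with supp(c) ⊆ Y. Then the alternating sum over dependent subsets of S satisfies Σ_{Y ⊆ S, Y dependent} (−1)^{|Y|} = (−1)^{q^2}·q; equivalently, Σ_{Y ⊆ S, Y not dependent} (−1)^{|Y|} = (−1)^{q^2−1}·q (the Euler characteristic of the restriction to S of the parity-check matroid of C_q has absolute value q). -/
noncomputable section

open MvPolynomial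

attribute [local instance] Classical.propDecidable

noncomputable instance {F : Type*} [Field F] [Fintype F] : Fintype (Plane F) :=
  haveI : Finite (Plane F) := Quotient.finite _
  Fintype.ofFinite _

/-! ### Combinatorics -/

theorem vrec_comb {α B : Type*} [Fintype B] (S : Finset α) (I : α → B → Prop)
    (hu : ∀ z ∈ S, ∀ b b', I z b → I z b' → b = b') (he : ∀ b, ∃ z ∈ S, I z b) [Nonempty B]
    (R : Finset α → Prop) (hR : ∀ Z, R Z ↔ ∃ b, ∀ z ∈ Z, I z b) :
    (∑ Z ∈ S.powerset, (if R Z then (-1 : ℤ) ^ Z.card else 0))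
      = 1 - (Fintype.card B : ℤ) := by
  have key : ∀ Z ∈ S.powerset, (if R Z then (-1 : ℤ) ^ Z.card else 0)
      = (∑ b : B, if ∀ z ∈ Z, I z b then (-1 : ℤ) ^ Z.card else 0)
        - (if Z = ∅ then (Fintype.card B : ℤ) - 1 else 0) := by
    intro Z hZ
    rw [Finset.mem_powerset] at hZ
    have hRZ := hR Z
    rcases Finset.eq_empty_or_nonempty Z with rfl | ⟨z, hz⟩
    · have h0 : R ∅ := by simp [hR]
      simp [h0]
    · have hne : Z ≠ ∅ := Finset.ne_empty_of_mem hz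
      rw [if_neg hne, sub_zero]
      by_cases h : R Z
      · rw [if_pos h]
        obtain ⟨b, hb⟩ := hRZ.1 h
        rw [Finset.sum_eq_single b]
        · rw [if_pos hb]
        · intro b' _ hb'
          rw [if_neg]
          intro h'
          exact hb' (hu z (hZ hz) _ _ (h' z hz) (hb z hz))
        · simp
      · rw [if_neg h]
        rw [hRZ] at h
        push Not at h
        symm
        apply Finset.sum_eq_zero
        intro b _
        rw [if_neg]
        push Not
        exact h b
  rw [Finset.sum_congr rfl key, Finset.sum_sub_distrib, Finset.sum_comm]
  have h0 : ∀ b : B, (∑ Z ∈ S.powerset, if ∀ z ∈ Z, I z b then (-1 : ℤ) ^ Z.card else 0) = 0 := by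
    intro b
    rw [← Finset.sum_filter]
    have : S.powerset.filter (fun Z => ∀ z ∈ Z, I z b) = (S.filter (fun z => I z b)).powerset := by
      ext Z
      simp only [Finset.mem_filter, Finset.mem_powerset, Finset.subset_iff]
      constructor
      · intro h x hx
        exact ⟨h.1 hx, h.2 x hx⟩
      · intro h
        exact ⟨fun x hx => (h hx).1, fun x hx => (h hx).2⟩
    rw [this]
    apply Finset.sum_powerset_neg_one_pow_card_of_nonempty
    obtain ⟨z, hz, hI⟩ := he b
    exact ⟨z, by simp [hz, hI]⟩
  rw [Finset.sum_eq_zero (fun b _ => h0 b)]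
  simp

theorem vrec_compl {α : Type*} (S : Finset α) (R : Finset α → Prop) :
    (∑ Y ∈ S.powerset, (if R (S \ Y) then (-1 : ℤ) ^ Y.card else 0))
      = (-1) ^ S.card * ∑ Z ∈ S.powerset, (if R Z then (-1 : ℤ) ^ Z.card else 0) := by
  rw [Finset.mul_sum]
  refine Finset.sum_bij' (fun Y _ => S \ Y) (fun Y _ => S \ Y) ?_ ?_ ?_ ?_ ?_
  · intro Y _; simp
  · intro Y _; simp
  · intro Y hY; simpa using hY
  · intro Y hY; simpa using hY
  · intro Y hY
    rw [Finset.mem_powerset] at hY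
    split_ifs
    · have := Finset.card_sdiff_add_card_eq_card hY
      rw [← this, ← pow_add, add_right_comm, pow_add, ← two_mul, pow_mul]
      simp
    · simp

/-! ### Polynomials of degree one and two as functions -/

theorem vrec_lin {F : Type*} [Field F] (l : MvPolynomial (Fin 3) F)
    (hl : l ∈ MvPolynomial.homogeneousSubmodule (Fin 3) F 1) :
    ∃ φ : Module.Dual F (Fin 3 → F), ∀ x, MvPolynomial.eval x l = φ x := by
  rw [homogeneousSubmodule_one_eq_span_X] at hl
  induction hl using Submodule.span_induction with
  | mem x h =>
    obtain ⟨i, rfl⟩ := h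
    exact ⟨LinearMap.proj i, fun x => by simp⟩
  | zero => exact ⟨0, by simp⟩
  | add x y _ _ hx hy =>
    obtain ⟨a, ha⟩ := hx
    obtain ⟨b, hb⟩ := hy
    exact ⟨a + b, fun x => by simp [ha, hb]⟩
  | smul c x _ hx =>
    obtain ⟨a, ha⟩ := hx
    exact ⟨c • a, fun x => by simp [ha]⟩

theorem vrec_lin' {F : Type*} [Field F] (φ : Module.Dual F (Fin 3 → F)) :
    ∃ l ∈ MvPolynomial.homogeneousSubmodule (Fin 3) F 1, ∀ x, MvPolynomial.eval x l = φ x := by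
  refine ⟨∑ i, φ (Pi.single i 1) • X i, ?_, ?_⟩
  · exact Submodule.sum_mem _ fun i _ => Submodule.smul_mem _ _ (isHomogeneous_X _ _)
  · intro x
    conv_rhs => rw [← Finset.univ_sum_single x, map_sum]
    rw [map_sum]
    refine Finset.sum_congr rfl fun i _ => ?_
    have : (Pi.single i (x i) : Fin 3 → F) = x i • Pi.single i 1 := by
      rw [← Pi.single_smul]; simp
    rw [this, map_smul φ]
    simp [mul_comm]

theorem vrec_quad {F : Type*} [Field F] (w : Fin 3 → F) (f : MvPolynomial (Fin 3) F)
    (hf : f ∈ MvPolynomial.homogeneousSubmodule (Fin 3) F 2) :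
    (∀ (t : F) x, MvPolynomial.eval (t • x) f = t ^ 2 * MvPolynomial.eval x f) ∧
    ∃ m : Module.Dual F (Fin 3 → F), ∀ x (t : F), MvPolynomial.eval (x + t • w) f
      = MvPolynomial.eval x f + t * m x + t ^ 2 * MvPolynomial.eval w f := by
  rw [← homogeneousSubmodule_one_pow, pow_two] at hf
  induction hf using Submodule.mul_induction_on' with
  | mem_mul_mem a ha b hb =>
    obtain ⟨φ, hφ⟩ := vrec_lin a ha
    obtain ⟨ψ, hψ⟩ := vrec_lin b hb
    refine ⟨fun t x => ?_, φ w • ψ + ψ w • φ, fun x t => ?_⟩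
    · simp [hφ, hψ]; ring
    · simp [hφ, hψ]; ring
  | add a _ b _ ha hb =>
    obtain ⟨h1, m1, hm1⟩ := ha
    obtain ⟨h2, m2, hm2⟩ := hb
    refine ⟨fun t x => ?_, m1 + m2, fun x t => ?_⟩
    · simp [h1, h2]; ring
    · simp [hm1, hm2]; ring

/-! ### Geometry -/

theorem vrec_rep {F : Type*} [Field F] (rep : Plane F → (Fin 3 → F))
    (hrep : ∀ p : Plane F, ∃ h : rep p ≠ 0, Projectivization.mk F (rep p) h = p)
    (v : Fin 3 → F) (hv : v ≠ 0) :
    ∃ a : F, a ≠ 0 ∧ rep (Projectivization.mk F v hv) = a • v := by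
  obtain ⟨h, e⟩ := hrep (Projectivization.mk F v hv)
  rw [Projectivization.mk_eq_mk_iff] at e
  obtain ⟨a, ha⟩ := e
  exact ⟨a, a.ne_zero, ha.symm⟩

/-- Characterization of the dependent subsets. -/
theorem vrec_dep {F : Type*} [Field F] (rep : Plane F → (Fin 3 → F))
    (hrep : ∀ p : Plane F, ∃ h : rep p ≠ 0, Projectivization.mk F (rep p) h = p)
    (φ : Module.Dual F (Fin 3 → F)) (P₀ : Plane F) (hP₀ : φ (rep P₀) ≠ 0)
    (Y : Set (Plane F)) (hY : ∀ p ∈ Y, φ (rep p) ≠ 0 ∧ p ≠ P₀) :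
    (∃ c ∈ VeroneseCode rep, c ≠ 0 ∧ {p : Plane F | c p ≠ 0} ⊆ Y) ↔
    ∃ m : Module.Dual F (Fin 3 → F), m ≠ 0 ∧ m (rep P₀) = 0 ∧
      ∀ p, φ (rep p) ≠ 0 → p ≠ P₀ → p ∉ Y → m (rep p) = 0 := by
  constructor
  · rintro ⟨c, ⟨f, hf, rfl⟩, hc, hsub⟩
    obtain ⟨hsq, m, hm⟩ := vrec_quad (rep P₀) f hf
    have hzero : ∀ p, p ∉ Y → eval (rep p) f = 0 := by
      intro p hp
      by_contra h
      exact hp (hsub (by simpa [aeval_eq_eval] using h))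
    have hw : eval (rep P₀) f = 0 := hzero _ fun h => (hY _ h).2 rfl
    have hker : ∀ x, φ x = 0 → eval x f = 0 := by
      intro x hx
      by_cases hx0 : x = 0
      · have := hsq 0 x
        simpa [hx0] using this
      · obtain ⟨a, ha, e⟩ := vrec_rep rep hrep x hx0
        have h1 := hzero (Projectivization.mk F x hx0) fun h => (hY _ h).1 (by simp [e, hx])
        rw [e, hsq] at h1
        simpa [ha] using h1
    have hmw : m (rep P₀) = 0 := by
      have h1 := hm (rep P₀) 1
      have h2 := hsq 2 (rep P₀)
      rw [two_smul] at h2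
      rw [one_smul, h2, hw] at h1
      simpa using h1.symm
    have hform : ∀ x, eval x f = φ x / φ (rep P₀) * m x := by
      intro x
      have h1 := hm (x - (φ x / φ (rep P₀)) • rep P₀) (φ x / φ (rep P₀))
      rw [sub_add_cancel, hker (x - (φ x / φ (rep P₀)) • rep P₀) (by simp [hP₀]), hw] at h1
      simpa [hmw] using h1
    refine ⟨m, ?_, hmw, ?_⟩
    · rintro rfl
      apply hc
      ext p
      simpa [aeval_eq_eval] using hform (rep p)
    · intro p h1 h2 h3
      have := hzero p h3
      rw [hform] at this
      simpa [h1, hP₀] using this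
  · rintro ⟨m, hm0, hmw, hm⟩
    obtain ⟨a, ha, hφ⟩ := vrec_lin' φ
    obtain ⟨b, hb, hψ⟩ := vrec_lin' m
    have hab : a * b ∈ homogeneousSubmodule (Fin 3) F 2 := IsHomogeneous.mul ha hb
    refine ⟨_, ⟨a * b, hab, rfl⟩, ?_, ?_⟩
    · obtain ⟨v, hv⟩ : ∃ v, m v ≠ 0 := by
        by_contra h
        push Not at h
        exact hm0 (LinearMap.ext h)
      obtain ⟨u, hu1, hu2⟩ : ∃ u, m u ≠ 0 ∧ φ u ≠ 0 := by
        by_cases h : φ v = 0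
        · exact ⟨v + rep P₀, by simpa [hmw] using hv, by simpa [h] using hP₀⟩
        · exact ⟨v, hv, h⟩
      have hu0 : u ≠ 0 := by rintro rfl; simp at hu1
      obtain ⟨t, ht, e⟩ := vrec_rep rep hrep u hu0
      intro h
      have := congrFun h (Projectivization.mk F u hu0)
      simp [aeval_eq_eval, hφ, hψ, e, ht, hu1, hu2] at this
    · intro p hp
      by_contra hpY
      have hp' : φ (rep p) ≠ 0 ∧ m (rep p) ≠ 0 := by
        simpa [aeval_eq_eval, hφ, hψ] using hp
      refine hp'.2 (hm p hp'.1 ?_ hpY)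
      rintro rfl
      exact hp'.2 hmw

theorem vrec_span {F : Type*} [Field F] (rep : Plane F → (Fin 3 → F))
    (hrep : ∀ p : Plane F, ∃ h : rep p ≠ 0, Projectivization.mk F (rep p) h = p)
    (p p' : Plane F) (h : rep p ∈ Submodule.span F {rep p'}) : p = p' := by
  obtain ⟨h1, e1⟩ := hrep p
  obtain ⟨h2, e2⟩ := hrep p'
  rw [← e1, ← e2, Projectivization.mk_eq_mk_iff']
  exact Submodule.mem_span_singleton.1 h

theorem vrec_finrank_dual {F : Type*} [Field F] (w : Fin 3 → F) (hw : w ≠ 0) :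
    Module.finrank F (LinearMap.ker (Module.Dual.eval F (Fin 3 → F) w)) = 2 := by
  have h : Module.Dual.eval F (Fin 3 → F) w ≠ 0 := by
    rwa [Ne, Module.eval_apply_eq_zero_iff]
  have := Module.Dual.finrank_ker_add_one_of_ne_zero h
  rw [Subspace.dual_finrank_eq] at this
  simpa using this

theorem vrec_finrank_ker {F : Type*} [Field F] (m : Module.Dual F (Fin 3 → F)) (hm : m ≠ 0) :
    Module.finrank F (LinearMap.ker m) = 2 := by
  have := Module.Dual.finrank_ker_add_one_of_ne_zero hm
  simpa using this

theorem vrec_unique_aux {F V : Type*} [Field F] [AddCommGroup V] [Module F V]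
    (hV : Module.finrank F V = 2) (g : Module.Dual F V) (hg : g ≠ 0)
    (b b' : Projectivization F V) (h : g b.rep = 0) (h' : g b'.rep = 0) : b = b' := by
  have : FiniteDimensional F V := Module.finite_of_finrank_eq_succ hV
  have hfr : Module.finrank F (LinearMap.ker g) = 1 := by
    have := Module.Dual.finrank_ker_add_one_of_ne_zero hg
    omega
  have hb0 : (⟨b.rep, h⟩ : LinearMap.ker g) ≠ 0 := by
    intro h0
    exact b.rep_nonzero (congrArg Subtype.val h0)
  obtain ⟨c, hc⟩ := (finrank_eq_one_iff_of_nonzero' _ hb0).1 hfr ⟨b'.rep, h'⟩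
  rw [← b.mk_rep, ← b'.mk_rep, eq_comm, Projectivization.mk_eq_mk_iff']
  exact ⟨c, congrArg Subtype.val hc⟩

theorem vrec_unique {F : Type*} [Field F] (w p : Fin 3 → F) (hw : w ≠ 0)
    (hp : p ∉ Submodule.span F {w})
    (b b' : Projectivization F (LinearMap.ker (Module.Dual.eval F (Fin 3 → F) w)))
    (h : b.rep.1 p = 0) (h' : b'.rep.1 p = 0) : b = b' := by
  refine vrec_unique_aux (vrec_finrank_dual w hw)
    ((Module.Dual.eval F (Fin 3 → F) p).comp (Submodule.subtype _)) ?_ b b' h h'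
  obtain ⟨f, hf, hle⟩ := Submodule.exists_le_ker_of_notMem hp
  have hfw : f w = 0 := hle (Submodule.mem_span_singleton_self w)
  intro h0
  exact hf (LinearMap.congr_fun h0 ⟨f, hfw⟩)

theorem vrec_point {F : Type*} [Field F] (rep : Plane F → (Fin 3 → F))
    (hrep : ∀ p : Plane F, ∃ h : rep p ≠ 0, Projectivization.mk F (rep p) h = p)
    (φ : Module.Dual F (Fin 3 → F)) (P₀ : Plane F) (hP₀ : φ (rep P₀) ≠ 0)
    (m : Module.Dual F (Fin 3 → F)) (hm : m ≠ 0) (hmw : m (rep P₀) = 0) :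
    ∃ p, φ (rep p) ≠ 0 ∧ p ≠ P₀ ∧ m (rep p) = 0 := by
  have hw : rep P₀ ≠ 0 := (hrep P₀).1
  obtain ⟨u, hu1, hu2⟩ : ∃ u, m u = 0 ∧ u ∉ Submodule.span F {rep P₀} := by
    by_contra hcon
    push Not at hcon
    have hle : LinearMap.ker m ≤ Submodule.span F {rep P₀} := fun u hu => hcon u hu
    have h1 := Submodule.finrank_mono hle
    rw [vrec_finrank_ker m hm, finrank_span_singleton hw] at h1
    omega
  obtain ⟨v, hv1, hv2, hv3⟩ : ∃ v, m v = 0 ∧ v ∉ Submodule.span F {rep P₀} ∧ φ v ≠ 0 := by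
    by_cases h : φ u = 0
    · refine ⟨u + rep P₀, by simp [hu1, hmw], ?_, by simpa [h] using hP₀⟩
      intro h'
      exact hu2 ((Submodule.add_mem_iff_left _ (Submodule.mem_span_singleton_self _)).1 h')
    · exact ⟨u, hu1, hu2, h⟩
  have hv0 : v ≠ 0 := by rintro rfl; simp at hv3
  obtain ⟨t, ht, e⟩ := vrec_rep rep hrep v hv0
  refine ⟨Projectivization.mk F v hv0, by simp [e, ht, hv3], ?_, by simp [e, hv1]⟩
  intro h
  apply hv2
  rw [← h, e]
  exact Submodule.mem_span_singleton.2 ⟨t⁻¹, by simp [smul_smul, ht]⟩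

theorem vrec_affine_card {F : Type*} [Field F] [Fintype F] (rep : Plane F → (Fin 3 → F))
    (hrep : ∀ p : Plane F, ∃ h : rep p ≠ 0, Projectivization.mk F (rep p) h = p)
    (φ : Module.Dual F (Fin 3 → F)) (x₀ : Fin 3 → F) (hx₀ : φ x₀ ≠ 0) :
    (Finset.univ.filter (fun p : Plane F => φ (rep p) ≠ 0)).card = Fintype.card F ^ 2 := by
  have hφ : φ ≠ 0 := by rintro rfl; simp at hx₀
  have h1 : Fintype.card (LinearMap.ker φ) = Fintype.card F ^ 2 := by
    rw [Module.card_eq_pow_finrank (K := F), vrec_finrank_ker φ hφ]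
  rw [← h1, ← Finset.card_univ]
  symm
  have hval : ∀ k : LinearMap.ker φ, φ (k.1 + x₀) = φ x₀ := by
    intro k
    have : φ k.1 = 0 := k.2
    simp [this]
  have hne : ∀ k : LinearMap.ker φ, k.1 + x₀ ≠ 0 := by
    intro k h
    have := hval k
    rw [h, map_zero] at this
    exact hx₀ this.symm
  refine Finset.card_bij (fun k _ => Projectivization.mk F (k.1 + x₀) (hne k)) ?_ ?_ ?_
  · intro k _
    obtain ⟨t, ht, e⟩ := vrec_rep rep hrep _ (hne k)
    simp only [Finset.mem_filter, Finset.mem_univ, true_and]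
    rw [e, map_smul, hval]
    simp [ht, hx₀]
  · intro k _ k' _ h
    rw [Projectivization.mk_eq_mk_iff'] at h
    obtain ⟨a, ha⟩ := h
    have h2 := congrArg φ ha
    rw [map_smul, hval, hval] at h2
    have ha1 : a = 1 := by
      simpa [hx₀] using h2
    rw [ha1, one_smul] at ha
    exact Subtype.ext (add_right_cancel ha).symm
  · intro p hp
    simp only [Finset.mem_filter, Finset.mem_univ, true_and] at hp
    refine ⟨⟨(φ x₀ / φ (rep p)) • rep p - x₀, by simp [hp]⟩, Finset.mem_univ _, ?_⟩
    obtain ⟨h, e⟩ := hrep p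
    conv_rhs => rw [← e]
    rw [Projectivization.mk_eq_mk_iff']
    exact ⟨φ x₀ / φ (rep p), by simp⟩

theorem veronese_restricted_euler_characteristic
    {F : Type*} [Field F] [Fintype F] (q : ℕ) (hq : Fintype.card F = q) (hq4 : 4 ≤ q)
    (rep : Plane F → (Fin 3 → F))
    (hrep : ∀ p : Plane F, ∃ h : rep p ≠ 0, Projectivization.mk F (rep p) h = p)
    (L : Set (Plane F))
    (hL : ∃ l : MvPolynomial (Fin 3) F, l ∈ MvPolynomial.homogeneousSubmodule (Fin 3) F 1 ∧
      l ≠ 0 ∧ L = {p : Plane F | MvPolynomial.eval (rep p) l = 0})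
    (P₀ : Plane F) (hP₀ : P₀ ∉ L) :
    (∑ Y : Finset (Plane F),
        (if ↑Y ⊆ (L ∪ {P₀})ᶜ ∧
            (∃ c ∈ VeroneseCode rep, c ≠ 0 ∧ {p : Plane F | c p ≠ 0} ⊆ ↑Y) then
          (-1 : ℤ) ^ Y.card else 0)) = (-1) ^ (q ^ 2) * q ∧
    (∑ Y : Finset (Plane F),
        (if ↑Y ⊆ (L ∪ {P₀})ᶜ ∧
            ¬(∃ c ∈ VeroneseCode rep, c ≠ 0 ∧ {p : Plane F | c p ≠ 0} ⊆ ↑Y) then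
          (-1 : ℤ) ^ Y.card else 0)) = (-1) ^ (q ^ 2 - 1) * q := by
  obtain ⟨l, hl, -, rfl⟩ := hL
  obtain ⟨φ, hφ⟩ := vrec_lin l hl
  have hP : φ (rep P₀) ≠ 0 := by simpa [hφ] using hP₀
  have hw : rep P₀ ≠ 0 := (hrep P₀).1
  set S : Finset (Plane F) := (Finset.univ.filter (fun p : Plane F => φ (rep p) ≠ 0)).erase P₀
    with hS
  have memS : ∀ p, p ∈ S ↔ φ (rep p) ≠ 0 ∧ p ≠ P₀ := by
    intro p; simp [hS, and_comm]
  have hScard : S.card = q ^ 2 - 1 := by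
    rw [hS, Finset.card_erase_of_mem (by simpa using hP),
      vrec_affine_card rep hrep φ (rep P₀) hP, hq]
  have hq2 : 16 ≤ q ^ 2 := by nlinarith
  have hSne : S.Nonempty := by
    rw [← Finset.card_pos]; omega
  have hsub : ∀ Y : Finset (Plane F),
      (↑Y ⊆ ({p : Plane F | MvPolynomial.eval (rep p) l = 0} ∪ {P₀})ᶜ) ↔ Y ∈ S.powerset := by
    intro Y
    rw [Finset.mem_powerset]
    constructor
    · intro h p hp
      rw [memS]
      simpa [hφ, and_comm] using h hp
    · intro h p hp
      have := (memS p).1 (h hp)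
      simpa [hφ, and_comm] using this
  have hred : ∀ (A D : Finset (Plane F) → Prop) (_ : ∀ Y, A Y ↔ Y ∈ S.powerset)
      (i1 : ∀ Y, Decidable (A Y ∧ D Y)) (i2 : ∀ Y, Decidable (D Y)),
      (∑ Y : Finset (Plane F), @ite ℤ (A Y ∧ D Y) (i1 Y) ((-1 : ℤ) ^ Y.card) 0) =
      ∑ Y ∈ S.powerset, @ite ℤ (D Y) (i2 Y) ((-1 : ℤ) ^ Y.card) 0 := by
    intro A D hA i1 i2
    rw [← Finset.sum_filter, ← Finset.sum_filter]
    congr 1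
    ext Y
    simp [hA]
  let N := LinearMap.ker (Module.Dual.eval F (Fin 3 → F) (rep P₀))
  have hNcard : Nat.card (Projectivization F N) = q + 1 := by
    rw [Projectivization.card_of_finrank_two F N (vrec_finrank_dual _ hw), Nat.card_eq_fintype_card,
      hq]
  have : Finite (Projectivization F N) := Nat.finite_of_card_ne_zero (by omega)
  have : Fintype (Projectivization F N) := Fintype.ofFinite _
  have : Nonempty (Projectivization F N) := by
    rw [← Finite.card_pos_iff]; omega
  let I : Plane F → Projectivization F N → Prop := fun p b => b.rep.1 (rep p) = 0
  have hcomb := vrec_comb S I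
    (fun z hz b b' h h' => vrec_unique (rep P₀) (rep z) hw
      (fun hc => ((memS z).1 hz).2 (vrec_span rep hrep _ _ hc)) b b' h h')
    (fun b => by
      obtain ⟨p, h1, h2, h3⟩ := vrec_point rep hrep φ P₀ hP b.rep.1
        (fun h => b.rep_nonzero (Subtype.ext h)) b.rep.2
      exact ⟨p, (memS p).2 ⟨h1, h2⟩, h3⟩)
    (fun Z => ∃ b, ∀ z ∈ Z, I z b) (fun Z => Iff.rfl)
  rw [← Nat.card_eq_fintype_card, hNcard] at hcomb
  have hdep : ∀ Y ∈ S.powerset,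
      ((∃ c ∈ VeroneseCode rep, c ≠ 0 ∧ {p : Plane F | c p ≠ 0} ⊆ ↑Y) ↔
        ∃ b, ∀ z ∈ S \ Y, I z b) := by
    intro Y hY
    rw [Finset.mem_powerset] at hY
    rw [vrec_dep rep hrep φ P₀ hP Y (fun p hp => (memS p).1 (hY hp))]
    constructor
    · rintro ⟨m, hm0, hmw, hm⟩
      have hn : (⟨m, hmw⟩ : N) ≠ 0 := fun h => hm0 (congrArg Subtype.val h)
      refine ⟨Projectivization.mk F ⟨m, hmw⟩ hn, fun z hz => ?_⟩
      rw [Finset.mem_sdiff, memS] at hz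
      obtain ⟨a, ha⟩ := Projectivization.exists_smul_eq_mk_rep F (⟨m, hmw⟩ : N) hn
      change (Projectivization.mk F (⟨m, hmw⟩ : N) hn).rep.1 (rep z) = 0
      rw [← ha]
      have := hm z hz.1.1 hz.1.2 (by simpa using hz.2)
      change (a : F) • m (rep z) = 0
      rw [this, smul_zero]
    · rintro ⟨b, hb⟩
      refine ⟨b.rep.1, fun h => b.rep_nonzero (Subtype.ext h), b.rep.2, fun p h1 h2 h3 => ?_⟩
      exact hb p (Finset.mem_sdiff.2 ⟨(memS p).2 ⟨h1, h2⟩, by simpa using h3⟩)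
  have hpow : (-1 : ℤ) ^ (q ^ 2) = -(-1) ^ (q ^ 2 - 1) := by
    obtain ⟨k, hk⟩ : ∃ k, q ^ 2 = k + 1 := ⟨q ^ 2 - 1, by omega⟩
    rw [hk, Nat.add_sub_cancel, pow_succ]
    ring
  have h1 : (∑ Y ∈ S.powerset,
      @ite ℤ (∃ c ∈ VeroneseCode rep, c ≠ 0 ∧ {p : Plane F | c p ≠ 0} ⊆ ↑Y)
        (Classical.propDecidable _) ((-1 : ℤ) ^ Y.card) 0) = (-1) ^ (q ^ 2) * q := by
    have := vrec_compl S (fun Z => ∃ b, ∀ z ∈ Z, I z b)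
    rw [hcomb, hScard] at this
    rw [hpow]
    have h2 : (-1 : ℤ) ^ (q ^ 2 - 1) * (1 - ((q + 1 : ℕ) : ℤ)) = -(-1) ^ (q ^ 2 - 1) * q := by
      push_cast; ring
    rw [← h2, ← this]
    refine Finset.sum_congr rfl fun Y hY => ?_
    by_cases h : ∃ c ∈ VeroneseCode rep, c ≠ 0 ∧ {p : Plane F | c p ≠ 0} ⊆ ↑Y
    · rw [if_pos h, if_pos ((hdep Y hY).1 h)]
    · rw [if_neg h, if_neg (fun h' => h ((hdep Y hY).2 h'))]
  refine ⟨(hred _ _ hsub _ _).trans h1, (hred _ _ hsub _ (fun _ => Classical.propDecidable _)).trans ?_⟩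
  have htot := Finset.sum_powerset_neg_one_pow_card_of_nonempty hSne
  have hadd : ∀ D : Finset (Plane F) → Prop,
      (∑ Y ∈ S.powerset, if D Y then (-1 : ℤ) ^ Y.card else 0) +
      (∑ Y ∈ S.powerset, @ite ℤ (¬ D Y) (Classical.propDecidable _) ((-1 : ℤ) ^ Y.card) 0) =
      ∑ Y ∈ S.powerset, (-1 : ℤ) ^ Y.card := by
    intro D
    rw [← Finset.sum_add_distrib]
    refine Finset.sum_congr rfl fun Y _ => ?_
    by_cases h : D Y <;> simp [h]
  have h3 := hadd (fun Y => ∃ c ∈ VeroneseCode rep, c ≠ 0 ∧ {p : Plane F | c p ≠ 0} ⊆ ↑Y)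
  rw [htot, h1, hpow] at h3
  linarith
end
end
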